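/- arXiv:2308.14722 — 5 statements merged into one kernel-verified Lean document; each statement's English description precedes it below -/
import Mathlib

section
/- Let d ≥ 1 be an integer and let f : [-1,1] → ℝ be a C^d function. Let Δ(f) = f({x ∈ [-1,1] : f'(x) = 0}) be its set of critical values and R_d(f) = (1/d!) · sup_{x∈[-1,1]} |f^{(d)}(x)|. Then: (i) for every ε ≥ R_d(f), M(ε, Δ(f)) ≤ d + 1; (ii) for every ε with 0 < ε ≤ R_d(f), M(ε, Δ(f)) ≤ (d+1) · (R_d(f)/ε)^{1/d}. -/
open Set

/-- The covering number `M(ε, S)`: the minimal number of closed intervals of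
radius `ε` needed to cover `S ⊆ ℝ`. -/
noncomputable def coveringNumber (ε : ℝ) (S : Set ℝ) : ℕ :=
  sInf {N : ℕ | ∃ t : Finset ℝ, t.card = N ∧ S ⊆ ⋃ c ∈ t, Metric.closedBall c ε}

/-- The Taylor constant `R_d(f) = (1/d!) · sup_{x ∈ [-1,1]} |f^{(d)}(x)|`. -/
noncomputable def taylorConst1 (d : ℕ) (f : ℝ → ℝ) : ℝ :=
  (1 / d.factorial) * ⨆ x ∈ Icc (-1 : ℝ) 1, |iteratedDerivWithin d f (Icc (-1 : ℝ) 1) x|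

/-- The set of critical values of `f : [-1,1] → ℝ`. -/
noncomputable def critValues1 (f : ℝ → ℝ) : Set ℝ :=
  f '' {x ∈ Icc (-1 : ℝ) 1 | derivWithin f (Icc (-1 : ℝ) 1) x = 0}

theorem iteratedDerivWithin_polynomial_eval {I : Set ℝ} (hI : UniqueDiffOn ℝ I)
    (P : Polynomial ℝ) (n : ℕ) {y : ℝ} (hy : y ∈ I) :
    iteratedDerivWithin n (fun t => P.eval t) I y =
      ((Polynomial.derivative^[n]) P).eval y := by
  induction n generalizing P with
  | zero => simp
  | succ n ih =>
    rw [iteratedDerivWithin_succ', Function.iterate_succ_apply, ← ih]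
    refine iteratedDerivWithin_congr (fun z hz => ?_) hy
    exact P.derivWithin (hI z hz)

/-- Generalized Rolle theorem. -/
theorem exists_iteratedDerivWithin_eq_zero {a b : ℝ} (hab : a < b) (n : ℕ) {h : ℝ → ℝ}
    (hh : ContDiffOn ℝ n h (Icc a b)) (x : Fin (n + 1) → ℝ) (hx : StrictMono x)
    (hmem : ∀ i, x i ∈ Icc a b) (hzero : ∀ i, h (x i) = 0) :
    ∃ ξ ∈ Icc a b, iteratedDerivWithin n h (Icc a b) ξ = 0 := by
  induction n generalizing h with
  | zero => exact ⟨x 0, hmem 0, by simpa using hzero 0⟩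
  | succ n ih =>
    have key : ∀ i : Fin (n + 1), ∃ y ∈ Ioo (x i.castSucc) (x i.succ),
        derivWithin h (Icc a b) y = 0 := by
      intro i
      obtain ⟨y, hy, hdy⟩ := exists_deriv_eq_zero (f := h) (hx (Fin.castSucc_lt_succ (i := i)))
        (hh.continuousOn.mono (Icc_subset_Icc (hmem _).1 (hmem _).2))
        (by rw [hzero, hzero])
      refine ⟨y, hy, ?_⟩
      rw [derivWithin_of_mem_nhds, hdy]
      exact Icc_mem_nhds ((hmem _).1.trans_lt hy.1) (hy.2.trans_le (hmem _).2)
    choose y hy hdy using key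
    obtain ⟨ξ, hξ, h0⟩ := ih (h := derivWithin h (Icc a b))
      (hh.derivWithin (uniqueDiffOn_Icc hab) (by norm_cast)) y
      (Fin.strictMono_iff_lt_succ.2 fun i => (hy i.castSucc).2.trans (hy i.succ).1)
      (fun i => ⟨(hmem _).1.trans (hy i).1.le, (hy i).2.le.trans (hmem _).2⟩) hdy
    exact ⟨ξ, hξ, by rw [iteratedDerivWithin_succ', h0]⟩

/-- A function vanishing on a finite set `s` of nodes is bounded by the nodal polynomial of `s`
times a bound for its derivative of order `s.card`. -/
theorem abs_mul_factorial_le_of_eq_zero {a b : ℝ} (hab : a < b) {g : ℝ → ℝ} (s : Finset ℝ)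
    (hg : ContDiffOn ℝ s.card g (Icc a b)) (hs : ↑s ⊆ Icc a b) (hzero : ∀ c ∈ s, g c = 0)
    {M : ℝ} (hM : ∀ ξ ∈ Icc a b, |iteratedDerivWithin s.card g (Icc a b) ξ| ≤ M)
    {x : ℝ} (hx : x ∈ Icc a b) :
    |g x| * s.card.factorial ≤ M * ∏ c ∈ s, |x - c| := by
  have hM0 : 0 ≤ M := (abs_nonneg _).trans (hM x hx)
  by_cases hxs : x ∈ s
  · rw [hzero x hxs]
    simp only [abs_zero, zero_mul]
    positivity
  set P : Polynomial ℝ := ∏ c ∈ s, (Polynomial.X - Polynomial.C c) with hP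
  have hPe : ∀ t, P.eval t = ∏ c ∈ s, (t - c) := fun t => by simp [hP, Polynomial.eval_prod]
  have hU := uniqueDiffOn_Icc hab
  have hcard : (insert x s).card = s.card + 1 := Finset.card_insert_of_notMem hxs
  have hPd : ContDiff ℝ s.card (fun t => P.eval t) := by
    simp only [hPe]
    fun_prop
  obtain ⟨ξ, hξ, h0⟩ := exists_iteratedDerivWithin_eq_zero hab s.card
    (h := (fun t => P.eval x * g t) - fun t => g x * P.eval t)
    ((contDiffOn_const.mul hg).sub (contDiffOn_const.mul hPd.contDiffOn))
    ((insert x s).orderEmbOfFin hcard) (OrderEmbedding.strictMono _)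
    (fun i => by
      have := (insert x s).orderEmbOfFin_mem hcard i
      rcases Finset.mem_insert.1 this with h | h
      · rw [h]; exact hx
      · exact hs h)
    (fun i => by
      have := (insert x s).orderEmbOfFin_mem hcard i
      rcases Finset.mem_insert.1 this with h | h
      · rw [h]; simp [mul_comm]
      · simp [hzero _ h, hPe, Finset.prod_eq_zero h])
  rw [iteratedDerivWithin_sub hξ hU ((contDiffOn_const.mul hg) ξ hξ)
      ((contDiffOn_const.mul hPd.contDiffOn) ξ hξ),
    iteratedDerivWithin_const_mul hξ hU _ (hg ξ hξ),
    iteratedDerivWithin_const_mul hξ hU _ (hPd.contDiffOn ξ hξ),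
    iteratedDerivWithin_polynomial_eval hU P _ hξ, hP,
    Polynomial.iterate_derivative_prod_X_sub_C le_rfl, ← hP, sub_eq_zero, hPe] at h0
  have h1 : (∏ c ∈ s, (x - c)) * iteratedDerivWithin s.card g (Icc a b) ξ
      = g x * s.card.factorial := by
    rw [h0]; simp
  calc |g x| * s.card.factorial = |g x * s.card.factorial| := by
        rw [abs_mul, Nat.abs_cast]
    _ = |iteratedDerivWithin s.card g (Icc a b) ξ| * ∏ c ∈ s, |x - c| := by
        rw [← h1, abs_mul, Finset.abs_prod, mul_comm]
    _ ≤ _ := by gcongr; exact hM ξ hξ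

theorem abs_iteratedDerivWithin_le_iSup {d : ℕ} {f : ℝ → ℝ}
    (hf : ContDiffOn ℝ d f (Icc (-1 : ℝ) 1)) {x : ℝ} (hx : x ∈ Icc (-1 : ℝ) 1) :
    |iteratedDerivWithin d f (Icc (-1 : ℝ) 1) x| ≤
      ⨆ x ∈ Icc (-1 : ℝ) 1, |iteratedDerivWithin d f (Icc (-1 : ℝ) 1) x| := by
  have hc := hf.continuousOn_iteratedDerivWithin le_rfl (uniqueDiffOn_Icc (by norm_num))
  obtain ⟨C, hC⟩ := isCompact_Icc.exists_bound_of_continuousOn hc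
  have hC0 : 0 ≤ C := (norm_nonneg _).trans (hC x hx)
  have hbdd : BddAbove (range fun x : ℝ =>
      ⨆ (_ : x ∈ Icc (-1 : ℝ) 1), |iteratedDerivWithin d f (Icc (-1 : ℝ) 1) x|) := by
    refine ⟨C, ?_⟩
    rintro _ ⟨y, rfl⟩
    exact Real.iSup_le (fun hy => hC y hy) hC0
  refine le_ciSup_of_le hbdd x ?_
  rw [ciSup_pos hx]

/-- Either `S` is covered by `n` intervals of radius `ε`, or it contains `n + 1` points whose
mutual distances exceed `2 * ε`. -/
theorem exists_cover_or_separated {ε : ℝ} (hε : 0 ≤ ε) (n : ℕ) {S : Set ℝ} (hS : BddBelow S) :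
    (∃ t : Finset ℝ, t.card ≤ n ∧ S ⊆ ⋃ c ∈ t, Metric.closedBall c ε) ∨
      ∃ t : Finset ℝ, t.card = n + 1 ∧ ↑t ⊆ S ∧ ∀ x ∈ t, ∀ y ∈ t, x < y → x + 2 * ε < y := by
  induction n generalizing S with
  | zero =>
    rcases S.eq_empty_or_nonempty with rfl | ⟨x, hx⟩
    · exact Or.inl ⟨∅, by simp⟩
    · refine Or.inr ⟨{x}, by simp, by simpa using hx, ?_⟩
      simp
  | succ n ih =>
    rcases S.eq_empty_or_nonempty with rfl | hne
    · exact Or.inl ⟨∅, by simp⟩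
    have hsub : S ∩ Ioi (sInf S + 2 * ε) ⊆ S := inter_subset_left
    rcases ih (hS.mono hsub) with ⟨t, ht, hcov⟩ | ⟨t, ht, htS, hsep⟩
    · refine Or.inl ⟨insert (sInf S + ε) t, (Finset.card_insert_le _ _).trans (by omega), ?_⟩
      intro y hy
      rw [Finset.set_biUnion_insert]
      by_cases hlt : sInf S + 2 * ε < y
      · exact Or.inr (hcov ⟨hy, hlt⟩)
      · left
        rw [Metric.mem_closedBall, Real.dist_eq, abs_le]
        have := csInf_le hS hy
        constructor <;> linarith
    · have htne : t.Nonempty := Finset.card_pos.1 (by omega)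
      obtain ⟨v, hv, hvlt⟩ := exists_lt_of_csInf_lt hne
        (show sInf S < t.min' htne - 2 * ε by
          have := (htS (t.min'_mem htne)).2
          simp only [mem_Ioi] at this
          linarith)
      have hlt : ∀ y ∈ t, v + 2 * ε < y := fun y hy => by
        linarith [t.min'_le y hy]
      have hvt : v ∉ t := fun h => by linarith [hlt v h]
      refine Or.inr ⟨insert v t, by rw [Finset.card_insert_of_notMem hvt, ht], ?_, ?_⟩
      · rw [Finset.coe_insert]
        exact insert_subset hv (htS.trans hsub)
      · intro x hx y hy hxy
        rcases Finset.mem_insert.1 hx with hxv | hxt <;>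
          rcases Finset.mem_insert.1 hy with hyv | hyt
        · linarith
        · rw [hxv]; exact hlt y hyt
        · linarith [hlt x hxt]
        · exact hsep x hxt y hyt hxy

theorem two_mul_pow_le_succ_pow (n : ℕ) (hn : 1 ≤ n) : 2 * n ^ n ≤ (n + 1) ^ n := by
  have h := one_add_mul_le_pow (a := (1 / n : ℝ)) (by have : (0:ℝ) ≤ 1 / n := by positivity
                                                      linarith) n
  have hn' : (0 : ℝ) < n := by exact_mod_cast hn
  have h2 : (2 : ℝ) * n ^ n ≤ (n + 1) ^ n := by
    calc (2 : ℝ) * n ^ n = (1 + n * (1 / n)) * n ^ n := by field_simp; norm_num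
      _ ≤ (1 + 1 / n) ^ n * n ^ n := by gcongr
      _ = (n + 1) ^ n := by rw [← mul_pow]; congr 1; field_simp
  exact_mod_cast h2

theorem two_pow_mul_factorial_le (k : ℕ) : 2 ^ k * k.factorial ≤ (k + 1) ^ k := by
  induction k with
  | zero => simp
  | succ k ih =>
    calc 2 ^ (k + 1) * (k + 1).factorial = 2 * (k + 1) * (2 ^ k * k.factorial) := by
          rw [Nat.factorial_succ]; ring
      _ ≤ 2 * (k + 1) * (k + 1) ^ k := by gcongr
      _ = 2 * (k + 1) ^ (k + 1) := by ring
      _ ≤ _ := two_mul_pow_le_succ_pow (k + 1) (by omega)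

theorem factorial_half_bound (d : ℕ) (hd : 1 ≤ d) :
    d * ((d / 2).factorial * ((d - 1) / 2).factorial) * 4 ^ d ≤ 4 * (d + 1) ^ d := by
  obtain ⟨k, rfl | rfl⟩ : ∃ k, d = 2 * k + 1 ∨ d = 2 * k + 2 := ⟨(d - 1) / 2, by omega⟩
  · have h1 : (2 * k + 1) / 2 = k := by omega
    have h2 : (2 * k + 1 - 1) / 2 = k := by omega
    have hk := two_pow_mul_factorial_le k
    rw [h1, h2]
    calc (2 * k + 1) * (k.factorial * k.factorial) * 4 ^ (2 * k + 1)
        = (2 * k + 1) * ((2 ^ k * k.factorial) * (2 ^ k * k.factorial)) * (4 * 4 ^ k) := by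
          rw [show (4 : ℕ) = 2 ^ 2 by norm_num, ← pow_mul, ← pow_mul]; ring
      _ ≤ (2 * k + 2) * ((k + 1) ^ k * (k + 1) ^ k) * (4 * 4 ^ k) := by gcongr; omega
      _ = 4 * (2 * k + 1 + 1) ^ (2 * k + 1) := by
          rw [show 2 * k + 1 + 1 = 2 * (k + 1) by ring, mul_pow,
            show (4 : ℕ) = 2 ^ 2 by norm_num, ← pow_mul]; ring
  · have h1 : (2 * k + 2) / 2 = k + 1 := by omega
    have h2 : (2 * k + 2 - 1) / 2 = k := by omega
    have hk := two_pow_mul_factorial_le k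
    rw [h1, h2]
    calc (2 * k + 2) * ((k + 1).factorial * k.factorial) * 4 ^ (2 * k + 2)
        = 8 * 4 ^ (k + 1) * (k + 1) * (k + 1) * ((2 ^ k * k.factorial) * (2 ^ k * k.factorial)) := by
          rw [Nat.factorial_succ, show (4 : ℕ) = 2 ^ 2 by norm_num, ← pow_mul, ← pow_mul]; ring
      _ ≤ 8 * 4 ^ (k + 1) * (k + 1) * (k + 1) * ((k + 1) ^ k * (k + 1) ^ k) := by gcongr
      _ = 4 * (2 * (2 * k + 2) ^ (2 * k + 2)) := by
          rw [show 2 * k + 2 = 2 * (k + 1) by ring, mul_pow 2 (k + 1),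
            show (4 : ℕ) = 2 ^ 2 by norm_num, ← pow_mul]; ring
      _ ≤ 4 * (2 * k + 2 + 1) ^ (2 * k + 2) := by gcongr; exact two_mul_pow_le_succ_pow _ (by omega)

theorem prod_le_one_of_sum_le_card {ι : Type*} [Fintype ι] {y : ι → ℝ} (h0 : ∀ i, 0 ≤ y i)
    (h : ∑ i, y i ≤ Fintype.card ι) : ∏ i, y i ≤ 1 := by
  calc ∏ i, y i ≤ ∏ i, Real.exp (y i - 1) :=
        Finset.prod_le_prod (fun i _ => h0 i) fun i _ => by linarith [Real.add_one_le_exp (y i - 1)]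
    _ = Real.exp (∑ i, (y i - 1)) := (Real.exp_sum _ _).symm
    _ ≤ 1 := by
        rw [Real.exp_le_one_iff, Finset.sum_sub_distrib]
        simpa using h

/-- The total length of a closed polygon visiting points of `[-1, 1]` in increasing order. -/
theorem sum_cyclic_abs_sub_le {k : ℕ} {x : ZMod (k + 1) → ℝ}
    (hx : StrictMono (fun i : Fin (k + 1) => x i)) (hmem : ∀ i, x i ∈ Icc (-1 : ℝ) 1) :
    ∑ i, |x (i + 1) - x i| ≤ 4 := by
  set y : Fin (k + 1) → ℝ := fun i => x i with hy
  change ∑ i : Fin (k + 1), |y (i + 1) - y i| ≤ 4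
  rw [Fin.sum_univ_castSucc]
  simp only [Fin.coeSucc_eq_succ, Fin.last_add_one]
  have h1 : ∀ i : Fin k, |y i.succ - y i.castSucc| = y i.succ - y i.castSucc := fun i =>
    abs_of_nonneg (sub_nonneg.2 (hx (Fin.castSucc_lt_succ (i := i))).le)
  simp only [h1, Finset.sum_sub_distrib]
  have h2 := Fin.sum_univ_succ y
  have h3 := Fin.sum_univ_castSucc y
  have h4 : |y 0 - y (Fin.last k)| ≤ 2 := by
    have a : y 0 ∈ Icc (-1 : ℝ) 1 := hmem _
    have b : y (Fin.last k) ∈ Icc (-1 : ℝ) 1 := hmem _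
    rw [abs_le]
    constructor <;> linarith [a.1, a.2, b.1, b.2]
  have h5 : y (Fin.last k) - y 0 ≤ 2 := by linarith [(abs_le.1 h4).1]
  linarith

/-- If nonnegative numbers arranged in a cycle of length `n` have sum at most `4`, then at some
position the product of the given sums over windows is at most its value for the uniform cycle. -/
theorem exists_prod_window_le {n : ℕ} [NeZero n] {γ : ZMod n → ℝ} (h0 : ∀ i, 0 ≤ γ i)
    (hsum : ∑ i, γ i ≤ 4) (p q : ℕ) :
    ∃ j, γ j * ((∏ m : Fin p, ∑ t ∈ Finset.range (m + 1), γ (j + t)) *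
        ∏ m : Fin q, ∑ t ∈ Finset.range (m + 1), γ (j - t)) ≤
      (4 / n) ^ (p + q + 1) * (p.factorial * q.factorial) := by
  have hn : (0 : ℝ) < n := by exact_mod_cast NeZero.pos n
  set w : ℝ := 4 / n with hw
  have hw0 : 0 < w := by positivity
  have hnw : n * w = 4 := by rw [hw]; field_simp
  let y : ZMod n → Option (Fin p ⊕ Fin q) → ℝ := fun j o => o.elim (γ j / w)
    (Sum.elim (fun m => (∑ t ∈ Finset.range (m + 1), γ (j + t)) / ((m + 1) * w))
      (fun m => (∑ t ∈ Finset.range (m + 1), γ (j - t)) / ((m + 1) * w)))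
  have hy0 : ∀ j o, 0 ≤ y j o := by
    rintro j (_ | m | m)
    · exact div_nonneg (h0 _) hw0.le
    · exact div_nonneg (Finset.sum_nonneg fun _ _ => h0 _) (by positivity)
    · exact div_nonneg (Finset.sum_nonneg fun _ _ => h0 _) (by positivity)
  have hcol : ∀ o, ∑ j, y j o ≤ n := by
    rintro (_ | m | m)
    · change ∑ j, γ j / w ≤ n
      rw [← Finset.sum_div, div_le_iff₀ hw0, hnw]
      exact hsum
    · change ∑ j, (∑ t ∈ Finset.range (m + 1), γ (j + t)) / ((m + 1) * w) ≤ n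
      rw [← Finset.sum_div, Finset.sum_comm, div_le_iff₀ (by positivity)]
      have : ∀ t : ℕ, ∑ j, γ (j + t) = ∑ j, γ j := fun t => Equiv.sum_comp (Equiv.addRight (t : ZMod n)) γ
      simp only [this, Finset.sum_const, Finset.card_range, nsmul_eq_mul]
      push_cast
      nlinarith [(m : ℕ).cast_nonneg (α := ℝ)]
    · change ∑ j, (∑ t ∈ Finset.range (m + 1), γ (j - t)) / ((m + 1) * w) ≤ n
      rw [← Finset.sum_div, Finset.sum_comm, div_le_iff₀ (by positivity)]
      have : ∀ t : ℕ, ∑ j, γ (j - t) = ∑ j, γ j := fun t => Equiv.sum_comp (Equiv.subRight (t : ZMod n)) γ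
      simp only [this, Finset.sum_const, Finset.card_range, nsmul_eq_mul]
      push_cast
      nlinarith [(m : ℕ).cast_nonneg (α := ℝ)]
  obtain ⟨j, -, hj⟩ := Finset.exists_le_of_sum_le (s := (Finset.univ : Finset (ZMod n)))
    (f := fun j => ∑ o, y j o) (g := fun _ => (Fintype.card (Option (Fin p ⊕ Fin q)) : ℝ))
    Finset.univ_nonempty (by
      rw [Finset.sum_comm, Finset.sum_const, Finset.card_univ, ZMod.card, nsmul_eq_mul]
      calc ∑ o, ∑ j, y j o ≤ ∑ _o : Option (Fin p ⊕ Fin q), (n : ℝ) :=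
            Finset.sum_le_sum fun o _ => hcol o
        _ = _ := by rw [Finset.sum_const, Finset.card_univ, nsmul_eq_mul, mul_comm])
  have hprod := prod_le_one_of_sum_le_card (hy0 j) hj
  rw [Fintype.prod_option, Fintype.prod_sum_type] at hprod
  have hfac : ∀ r : ℕ, ∏ m : Fin r, (((m : ℕ) + 1 : ℝ) * w) = r.factorial * w ^ r := by
    intro r
    rw [Finset.prod_mul_distrib, Finset.prod_const, Finset.card_univ, Fintype.card_fin,
      Fin.prod_univ_eq_prod_range (fun m : ℕ => (m + 1 : ℝ)), ← Finset.prod_range_add_one_eq_factorial]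
    push_cast
    rfl
  refine ⟨j, ?_⟩
  simp only [y, Option.elim, Sum.elim_inl, Sum.elim_inr, Finset.prod_div_distrib, hfac] at hprod
  rw [← mul_div_mul_comm, ← mul_div_mul_comm, div_le_one (by positivity)] at hprod
  refine hprod.trans (le_of_eq ?_)
  ring

theorem natCast_zmod_injOn {n r : ℕ} (hr : r ≤ n) {a b : ℕ} (ha : a < r) (hb : b < r)
    (h : (a : ZMod n) = b) : a = b := by
  rw [ZMod.natCast_eq_natCast_iff', Nat.mod_eq_of_lt (ha.trans_le hr),
    Nat.mod_eq_of_lt (hb.trans_le hr)] at h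
  exact h

/-- The product of distances from a point `y` to `p` nodes following and `q` nodes preceding it
in cyclic order, as a product over a finite set of nodes. -/
theorem exists_nodes {n : ℕ} {x : ZMod n → ℝ} (hx : Function.Injective x) (j : ZMod n) {p q : ℕ}
    (hpq : p + q < n) :
    ∃ s : Finset ℝ, s.card = p + q ∧ ↑s ⊆ range x ∧ ∀ y : ℝ, ∏ c ∈ s, |y - c| =
      (∏ m : Fin p, |y - x (j + m + 1)|) * ∏ m : Fin q, |y - x (j - m)| := by
  let e : Fin p ⊕ Fin q → ℝ := Sum.elim (fun m => x (j + (m : ℕ) + 1)) (fun m => x (j - (m : ℕ)))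
  have he : Function.Injective e := by
    rintro (a | a) (b | b) hab
    · have h := hx hab
      congr 1
      exact Fin.ext (natCast_zmod_injOn (by omega : p ≤ n) a.2 b.2 (by simpa using h))
    · exfalso
      have h : j + (a : ℕ) + 1 = j - (b : ℕ) := hx hab
      have h' : ((a + b + 1 : ℕ) : ZMod n) = (0 : ℕ) := by
        push_cast
        linear_combination h
      have := natCast_zmod_injOn (r := p + q) hpq.le (by have := a.2; have := b.2; omega)
        (by have := a.2; omega) h'
      omega
    · exfalso
      have h : j - (a : ℕ) = j + (b : ℕ) + 1 := hx hab
      have h' : ((a + b + 1 : ℕ) : ZMod n) = (0 : ℕ) := by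
        push_cast
        linear_combination -h
      have := natCast_zmod_injOn (r := p + q) hpq.le (by have := a.2; have := b.2; omega)
        (by have := a.2; omega) h'
      omega
    · have h := hx hab
      congr 1
      exact Fin.ext (natCast_zmod_injOn (by omega : q ≤ n) a.2 b.2 (by simpa using h))
  refine ⟨Finset.univ.map ⟨e, he⟩, by simp, ?_, fun y => ?_⟩
  · intro c hc
    simp only [Finset.coe_map, Finset.coe_univ, image_univ, Function.Embedding.coeFn_mk] at hc
    obtain ⟨a | a, rfl⟩ := hc
    · exact ⟨_, rfl⟩
    · exact ⟨_, rfl⟩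
  · rw [Finset.prod_map, Fintype.prod_sum_type]
    rfl

theorem abs_sub_node_le {n : ℕ} (x : ZMod n → ℝ) (j : ZMod n) {y : ℝ}
    (hy : y ∈ uIcc (x j) (x (j + 1))) (m : ℕ) :
    |y - x (j + m + 1)| ≤ ∑ t ∈ Finset.range (m + 1), |x (j + t + 1) - x (j + t)| := by
  induction m with
  | zero =>
    simp only [Nat.cast_zero, add_zero, zero_add, Finset.range_one, Finset.sum_singleton]
    rw [abs_sub_comm]
    exact abs_sub_right_of_mem_uIcc hy
  | succ m ih =>
    rw [Finset.sum_range_succ]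
    refine (abs_sub_le _ (x (j + m + 1)) _).trans (add_le_add ih ?_)
    rw [abs_sub_comm]
    simp only [Nat.cast_succ, ← add_assoc]
    exact le_rfl

theorem abs_sub_node_le' {n : ℕ} (x : ZMod n → ℝ) (j : ZMod n) {y : ℝ}
    (hy : y ∈ uIcc (x j) (x (j + 1))) (m : ℕ) :
    |y - x (j - m)| ≤ ∑ t ∈ Finset.range (m + 1), |x (j - t + 1) - x (j - t)| := by
  induction m with
  | zero =>
    simp only [Nat.cast_zero, sub_zero, zero_add, Finset.range_one, Finset.sum_singleton]
    exact abs_sub_left_of_mem_uIcc hy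
  | succ m ih =>
    rw [Finset.sum_range_succ]
    refine (abs_sub_le _ (x (j - m)) _).trans (add_le_add ih (le_of_eq ?_))
    push_cast
    congr 3
    ring

theorem abs_sub_add_abs_sub_of_mem_uIcc {a b y : ℝ} (hy : y ∈ uIcc a b) :
    |y - a| + |y - b| = |b - a| := by
  rcases mem_uIcc.1 hy with ⟨h1, h2⟩ | ⟨h1, h2⟩
  · rw [abs_of_nonneg (by linarith : 0 ≤ y - a), abs_of_nonpos (by linarith : y - b ≤ 0),
      abs_of_nonneg (by linarith : 0 ≤ b - a)]
    ring
  · rw [abs_of_nonpos (by linarith : y - a ≤ 0), abs_of_nonneg (by linarith : 0 ≤ y - b),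
      abs_of_nonpos (by linarith : b - a ≤ 0)]
    ring

theorem prod_abs_sub_nodes_le_half {n : ℕ} (x : ZMod n → ℝ) (j : ZMod n) {y : ℝ}
    (hy : y ∈ uIcc (x j) (x (j + 1))) (p q : ℕ) :
    (∏ m : Fin (p + 1), |y - x (j + m + 1)|) * ∏ m : Fin (q + 1), |y - x (j - m)| ≤
      1 / 2 * ((∏ m : Fin (p + 1), ∑ t ∈ Finset.range (m + 1), |x (j + t + 1) - x (j + t)|) *
        ∏ m : Fin (q + 1), ∑ t ∈ Finset.range (m + 1), |x (j - t + 1) - x (j - t)|) := by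
  simp only [Fin.prod_univ_succ (n := p), Fin.prod_univ_succ (n := q), Fin.val_zero, Nat.cast_zero,
    add_zero, sub_zero, zero_add, Finset.range_one, Finset.sum_singleton]
  have h1 : ∏ m : Fin p, |y - x (j + (m.succ : ℕ) + 1)| ≤
      ∏ m : Fin p, ∑ t ∈ Finset.range (m.succ + 1), |x (j + t + 1) - x (j + t)| :=
    Finset.prod_le_prod (fun _ _ => abs_nonneg _) fun m _ => abs_sub_node_le x j hy _
  have h2 : ∏ m : Fin q, |y - x (j - (m.succ : ℕ))| ≤
      ∏ m : Fin q, ∑ t ∈ Finset.range (m.succ + 1), |x (j - t + 1) - x (j - t)| :=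
    Finset.prod_le_prod (fun _ _ => abs_nonneg _) fun m _ => abs_sub_node_le' x j hy _
  have h3 : |y - x (j + 1)| * |y - x j| ≤ 1 / 2 * (|x (j + 1) - x j| * |x (j + 1) - x j|) := by
    rw [← abs_sub_add_abs_sub_of_mem_uIcc hy]
    nlinarith [sq_nonneg |y - x j|, sq_nonneg |y - x (j + 1)|]
  have h4 : 0 ≤ ∏ m : Fin p, |y - x (j + (m.succ : ℕ) + 1)| :=
    Finset.prod_nonneg fun _ _ => abs_nonneg _
  have h5 : 0 ≤ ∏ m : Fin q, |y - x (j - (m.succ : ℕ))| :=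
    Finset.prod_nonneg fun _ _ => abs_nonneg _
  calc _ = (|y - x (j + 1)| * |y - x j|) * ((∏ m : Fin p, |y - x (j + (m.succ : ℕ) + 1)|) *
        ∏ m : Fin q, |y - x (j - (m.succ : ℕ))|) := by ring
    _ ≤ (1 / 2 * (|x (j + 1) - x j| * |x (j + 1) - x j|)) *
        ((∏ m : Fin p, ∑ t ∈ Finset.range (m.succ + 1), |x (j + t + 1) - x (j + t)|) *
        ∏ m : Fin q, ∑ t ∈ Finset.range (m.succ + 1), |x (j - t + 1) - x (j - t)|) := by
          gcongr
    _ = _ := by ring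

theorem abs_derivWithin_le_taylorConst1 {d : ℕ} (hd : 1 ≤ d) {f : ℝ → ℝ}
    (hf : ContDiffOn ℝ d f (Icc (-1 : ℝ) 1)) {s : Finset ℝ} (hs : s.card + 1 = d)
    (hsub : ↑s ⊆ {x ∈ Icc (-1 : ℝ) 1 | derivWithin f (Icc (-1 : ℝ) 1) x = 0}) {y : ℝ}
    (hy : y ∈ Icc (-1 : ℝ) 1) :
    |derivWithin f (Icc (-1 : ℝ) 1) y| ≤ d * taylorConst1 d f * ∏ c ∈ s, |y - c| := by
  subst hs
  have h := abs_mul_factorial_le_of_eq_zero (a := -1) (b := 1) (by norm_num) s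
    (hf.derivWithin (uniqueDiffOn_Icc (by norm_num)) (by norm_cast))
    (fun c hc => (hsub hc).1) (fun c hc => (hsub hc).2)
    (fun ξ hξ => by
      rw [← iteratedDerivWithin_succ']
      exact abs_iteratedDerivWithin_le_iSup hf hξ) hy
  rw [taylorConst1, Nat.factorial_succ]
  rw [← le_div_iff₀ (by positivity)] at h
  refine h.trans (le_of_eq ?_)
  push_cast
  field_simp

theorem lt_of_separated_critValues {d : ℕ} (hd : 1 ≤ d) {f : ℝ → ℝ}
    (hf : ContDiffOn ℝ d f (Icc (-1 : ℝ) 1)) {u : Finset ℝ} {n : ℕ} (hcard : u.card = n)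
    (hn : d + 2 ≤ n) (hu : ↑u ⊆ {x ∈ Icc (-1 : ℝ) 1 | derivWithin f (Icc (-1 : ℝ) 1) x = 0})
    {δ : ℝ} (hsep : ∀ a ∈ u, ∀ b ∈ u, a ≠ b → δ < |f a - f b|) (hR : 0 ≤ taylorConst1 d f) :
    δ < 2 * taylorConst1 d f * ((d + 1) / n) ^ d := by
  obtain ⟨k, rfl⟩ : ∃ k, n = k + 1 := ⟨n - 1, by omega⟩
  set R := taylorConst1 d f with hRdef
  set I := Icc (-1 : ℝ) 1 with hI
  let x : ZMod (k + 1) → ℝ := fun i => u.orderEmbOfFin hcard i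
  have hxmono : StrictMono (fun i : Fin (k + 1) => x i) := (u.orderEmbOfFin hcard).strictMono
  have hxinj : Function.Injective x := hxmono.injective
  have hxu : ∀ i, x i ∈ u := fun i => u.orderEmbOfFin_mem hcard i
  have hxI : ∀ i, x i ∈ I := fun i => (hu (hxu i)).1
  obtain ⟨p, q, hp, hq⟩ : ∃ p q, p = d / 2 ∧ q = (d - 1) / 2 := ⟨_, _, rfl, rfl⟩
  have hpq : p + q + 1 = d := by omega
  obtain ⟨j, hj⟩ := exists_prod_window_le (γ := fun i => |x (i + 1) - x i|)
    (fun _ => abs_nonneg _) (sum_cyclic_abs_sub_le hxmono hxI) p q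
  set W := (∏ m : Fin p, ∑ t ∈ Finset.range (m + 1), |x (j + t + 1) - x (j + t)|) *
        ∏ m : Fin q, ∑ t ∈ Finset.range (m + 1), |x (j - t + 1) - x (j - t)| with hW
  have hseg : uIcc (x j) (x (j + 1)) ⊆ I :=
    (convex_Icc (-1 : ℝ) 1).ordConnected.uIcc_subset (hxI _) (hxI _)
  set κ : ℝ := if d = 1 then 1 else 1 / 2 with hκ
  have hder : ∀ y ∈ uIcc (x j) (x (j + 1)), |derivWithin f I y| ≤ d * R * (κ * W) := by
    intro y hy
    have hbound : ∀ s : Finset ℝ, s.card + 1 = d → ↑s ⊆ range x → ∏ c ∈ s, |y - c| ≤ κ * W →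
        |derivWithin f I y| ≤ d * R * (κ * W) := by
      intro s hs hsx hle
      refine (abs_derivWithin_le_taylorConst1 hd hf hs ?_ (hseg hy)).trans (by gcongr)
      rintro c hc
      obtain ⟨i, rfl⟩ := hsx hc
      exact hu (hxu i)
    rcases (by omega : d = 1 ∨ d = 2 ∨ 3 ≤ d) with h1 | h2 | h3
    · obtain rfl : p = 0 := by omega
      obtain rfl : q = 0 := by omega
      exact hbound ∅ (by simp [h1]) (by simp) (by simp [hκ, hW, h1])
    · obtain rfl : p = 1 := by omega
      obtain rfl : q = 0 := by omega
      have hval : κ * W = 1 / 2 * |x (j + 1) - x j| := by simp [hκ, hW, h2]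
      have hadd := abs_sub_add_abs_sub_of_mem_uIcc hy
      rcases le_total |y - x j| |y - x (j + 1)| with h | h
      · exact hbound {x j} (by simp [h2]) (by simp) (by
          rw [hval, Finset.prod_singleton]; linarith)
      · exact hbound {x (j + 1)} (by simp [h2]) (by simp) (by
          rw [hval, Finset.prod_singleton]; linarith)
    · obtain ⟨s, hs, hsx, hprod⟩ := exists_nodes hxinj j (p := p) (q := q) (by omega)
      refine hbound s (by omega) hsx ?_
      rw [hprod]
      obtain ⟨p, rfl⟩ : ∃ p', p = p' + 1 := ⟨p - 1, by omega⟩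
      obtain ⟨q, rfl⟩ : ∃ q', q = q' + 1 := ⟨q - 1, by omega⟩
      rw [hκ, if_neg (by omega)]
      exact prod_abs_sub_nodes_le_half x j hy p q
  have hdiff : DifferentiableOn ℝ f I := hf.differentiableOn (by
    have : d ≠ 0 := by omega
    exact_mod_cast this)
  have hlip : |f (x (j + 1)) - f (x j)| ≤ d * R * (κ * W) * |x (j + 1) - x j| :=
    (convex_uIcc (x j) (x (j + 1))).norm_image_sub_le_of_norm_hasDerivWithin_le
      (fun y hy => ((hdiff y (hseg hy)).hasDerivWithinAt).mono hseg) hder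
      left_mem_uIcc right_mem_uIcc
  have hne : x (j + 1) ≠ x j := by
    intro h
    have h' : ((1 : ℕ) : ZMod (k + 1)) = (0 : ℕ) := by
      have := hxinj h
      simpa using this
    have := natCast_zmod_injOn (r := k + 1) le_rfl (by omega) (by omega) h'
    omega
  have hκ0 : 0 ≤ κ := by rw [hκ]; split_ifs <;> norm_num
  have hnum : d * (p.factorial * q.factorial) * κ * 4 ^ d ≤ (2 : ℝ) * (d + 1) ^ d := by
    by_cases h1 : d = 1
    · obtain rfl : p = 0 := by omega
      obtain rfl : q = 0 := by omega
      rw [hκ, if_pos h1, h1]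
      norm_num
    · have h := factorial_half_bound d hd
      rw [← hp, ← hq] at h
      have h' : (d : ℝ) * (p.factorial * q.factorial) * 4 ^ d ≤ 4 * (d + 1) ^ d := by
        exact_mod_cast h
      rw [hκ, if_neg h1]
      linarith
  have hn0 : (0 : ℝ) < ((k + 1 : ℕ) : ℝ) := by positivity
  calc δ < |f (x (j + 1)) - f (x j)| := hsep _ (hxu _) _ (hxu _) hne
    _ ≤ d * R * κ * (|x (j + 1) - x j| * W) := hlip.trans (le_of_eq (by ring))
    _ ≤ d * R * κ * ((4 / (k + 1 : ℕ)) ^ (p + q + 1) * (p.factorial * q.factorial)) := by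
        gcongr
    _ = R * (d * (p.factorial * q.factorial) * κ * 4 ^ d) / (k + 1 : ℕ) ^ d := by
        rw [hpq, div_pow]; ring
    _ ≤ R * (2 * (d + 1) ^ d) / (k + 1 : ℕ) ^ d := by gcongr
    _ = _ := by rw [div_pow]; ring

/-- If the set of critical values cannot be covered by `N` balls of radius `ε`, then `ε` is small
in terms of the Taylor constant. -/
theorem lt_of_lt_coveringNumber {d : ℕ} (hd : 1 ≤ d) {f : ℝ → ℝ}
    (hf : ContDiffOn ℝ d f (Icc (-1 : ℝ) 1)) (hR : 0 ≤ taylorConst1 d f) {ε : ℝ} (hε : 0 ≤ ε)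
    {N : ℕ} (hN : d + 1 ≤ N) (h : N < coveringNumber ε (critValues1 f)) :
    ε < taylorConst1 d f * ((d + 1) / (N + 1 : ℕ)) ^ d := by
  have hbdd : BddBelow (critValues1 f) :=
    ((isCompact_Icc.image_of_continuousOn hf.continuousOn).bddBelow).mono
      (image_mono fun _ hx => hx.1)
  rcases exists_cover_or_separated hε N hbdd with ⟨t, ht, hcov⟩ | ⟨t, ht, hsub, hsep⟩
  · have hle : coveringNumber ε (critValues1 f) ≤ t.card := Nat.sInf_le ⟨t, rfl, hcov⟩
    exact absurd (hle.trans ht) (not_le.2 h)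
  · obtain ⟨u, hu, hinj, rfl⟩ := Finset.exists_subset_injOn_image_eq_of_surjOn _ _ hsub
    have hlt := lt_of_separated_critValues hd hf
      ((Finset.card_image_of_injOn hinj).symm.trans ht) (by omega) hu (δ := 2 * ε)
      (fun a ha b hb hab => by
        have hfa := Finset.mem_image_of_mem f ha
        have hfb := Finset.mem_image_of_mem f hb
        rcases lt_or_gt_of_ne (fun hf => hab (hinj ha hb hf)) with hlt | hlt
        · rw [abs_sub_comm]
          exact (lt_sub_iff_add_lt'.2 (hsep _ hfa _ hfb hlt)).trans_le (le_abs_self _)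
        · exact (lt_sub_iff_add_lt'.2 (hsep _ hfb _ hfa hlt)).trans_le (le_abs_self _)) hR
    linarith

/-- one-dimensional entropy bounds for the set of critical values,
with the explicit constant `c(1,d) = d + 1`. -/
theorem stmt_5 (d : ℕ) (hd : 1 ≤ d) (f : ℝ → ℝ)
    (hf : ContDiffOn ℝ d f (Icc (-1 : ℝ) 1)) :
    (∀ ε : ℝ, taylorConst1 d f ≤ ε →
      (coveringNumber ε (critValues1 f) : ℝ) ≤ d + 1) ∧
    (∀ ε : ℝ, 0 < ε → ε ≤ taylorConst1 d f →
      (coveringNumber ε (critValues1 f) : ℝ)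
        ≤ (d + 1) * (taylorConst1 d f / ε) ^ ((1 : ℝ) / d)) := by
  have hR : 0 ≤ taylorConst1 d f :=
    mul_nonneg (by positivity) (Real.iSup_nonneg fun _ => Real.iSup_nonneg fun _ => abs_nonneg _)
  have hd0 : d ≠ 0 := by omega
  refine ⟨fun ε hε => ?_, fun ε hε hεR => ?_⟩
  · by_contra! hlt
    have h := lt_of_lt_coveringNumber hd hf hR (hR.trans hε) le_rfl (by exact_mod_cast hlt)
    have hle : (((d : ℝ) + 1) / (d + 1 + 1 : ℕ)) ^ d ≤ 1 := by
      refine pow_le_one₀ (by positivity) ((div_le_one (by positivity)).2 ?_)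
      push_cast
      linarith
    linarith [mul_le_of_le_one_right hR hle]
  · by_contra! hlt
    set X : ℝ := (taylorConst1 d f / ε) ^ ((1 : ℝ) / d) with hX
    have hX1 : 1 ≤ X := Real.one_le_rpow ((one_le_div hε).2 hεR) (by positivity)
    have hXd : X ^ d = taylorConst1 d f / ε := by
      rw [hX, one_div]
      exact Real.rpow_inv_natCast_pow (by positivity) hd0
    obtain ⟨N, hN⟩ : ∃ N, coveringNumber ε (critValues1 f) = N + 1 := by
      refine Nat.exists_eq_succ_of_ne_zero fun h0 => ?_
      rw [h0, Nat.cast_zero] at hlt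
      exact absurd hlt (not_lt.2 (by positivity))
    rw [hN] at hlt
    have hdN : d + 1 ≤ N := by
      have : ((d : ℝ) + 1) < (N + 1 : ℕ) := by nlinarith [(d.cast_nonneg : (0 : ℝ) ≤ d)]
      have : d + 1 < N + 1 := by exact_mod_cast this
      omega
    have h := lt_of_lt_coveringNumber hd hf hR hε.le hdN (by omega)
    have hle : ((d : ℝ) + 1) / (N + 1 : ℕ) ≤ 1 / X := by
      rw [div_le_div_iff₀ (by positivity) (by positivity)]
      linarith
    have hfin : taylorConst1 d f * (((d : ℝ) + 1) / (N + 1 : ℕ)) ^ d ≤ ε := by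
      calc _ ≤ taylorConst1 d f * (1 / X) ^ d := by gcongr
        _ = ε := by
          have : taylorConst1 d f ≠ 0 := (hε.trans_le hεR).ne'
          rw [div_pow, one_pow, hXd]
          field_simp
    linarith
end

section
/- Let d ≥ 1 be an integer and let f : [-1,1] → ℝ be a C^d function with set of critical values Δ = f({x ∈ [-1,1] : f'(x) = 0}), and let R_d(f) = (1/d!) · sup_{x∈[-1,1]} |f^{(d)}(x)|. If ε₀ > 0 is such that the covering number satisfies M(ε₀, Δ) ≥ d + 2, then R_d(f) ≥ (1 + 1/(d+1))^d · ε₀ > 0. -/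
open Set

/-- If `g` is `n` times differentiable and has more than `n` zeros, then its `n`-th derivative
vanishes somewhere. -/
theorem exists_iteratedDerivWithin_eq_zero_s6 {u v : ℝ} (huv : u < v) {n : ℕ} {g : ℝ → ℝ}
    (hg : ContDiffOn ℝ n g (Icc u v)) {s : Finset ℝ} (hs : n < s.card)
    (hsub : ∀ x ∈ s, x ∈ Icc u v) (hzero : ∀ x ∈ s, g x = 0) :
    ∃ ξ ∈ Icc u v, iteratedDerivWithin n g (Icc u v) ξ = 0 := by
  induction n generalizing g s with
  | zero =>
    obtain ⟨x, hx⟩ := Finset.card_pos.1 hs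
    exact ⟨x, hsub x hx, by simpa using hzero x hx⟩
  | succ n ih =>
    let e := s.orderEmbOfCardLe (show n + 2 ≤ s.card from hs)
    have he : ∀ i, e i ∈ s := s.orderEmbOfCardLe_mem _
    have hroot : ∀ i : Fin (n + 1), ∃ c ∈ Ioo (e i.castSucc) (e i.succ),
        derivWithin g (Icc u v) c = 0 := by
      intro i
      have hIcc : Icc (e i.castSucc) (e i.succ) ⊆ Icc u v :=
        Icc_subset_Icc (hsub _ (he _)).1 (hsub _ (he _)).2
      obtain ⟨c, hc, hc0⟩ := exists_deriv_eq_zero (e.strictMono i.castSucc_lt_succ)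
        (hg.continuousOn.mono hIcc) ((hzero _ (he _)).trans (hzero _ (he _)).symm)
      refine ⟨c, hc, ?_⟩
      rw [derivWithin_of_mem_nhds, hc0]
      exact Filter.mem_of_superset (Icc_mem_nhds hc.1 hc.2) hIcc
    choose c hc hc0 using hroot
    have hcmono : StrictMono c := fun i j hij =>
      ((hc i).2.trans_le (e.monotone (Fin.succ_le_castSucc_iff.2 hij))).trans (hc j).1
    rw [iteratedDerivWithin_succ']
    refine ih (s := Finset.univ.image c)
      (hg.derivWithin (uniqueDiffOn_Icc huv) (by norm_cast)) ?_ ?_ ?_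
    · simp [Finset.card_image_of_injective _ hcmono.injective]
    · simp only [Finset.mem_image, Finset.mem_univ, true_and, forall_exists_index,
        forall_apply_eq_imp_iff]
      exact fun i => ⟨(hsub _ (he _)).1.trans (hc i).1.le, (hc i).2.le.trans (hsub _ (he _)).2⟩
    · simpa using hc0

open Polynomial in
theorem iteratedDerivWithin_polynomial_eval_s6 {s : Set ℝ} (hs : UniqueDiffOn ℝ s) (p : ℝ[X]) (k : ℕ)
    {x : ℝ} (hx : x ∈ s) :
    iteratedDerivWithin k (fun t => p.eval t) s x = (derivative^[k] p).eval x := by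
  induction k generalizing x with
  | zero => simp
  | succ k ih =>
    rw [iteratedDerivWithin_succ, derivWithin_congr (fun _ h => ih h) (ih hx),
      Polynomial.derivWithin _ (hs x hx), Function.iterate_succ_apply']

open Polynomial in
theorem iterate_derivative_of_monic {p : ℝ[X]} (hp : p.Monic) :
    derivative^[p.natDegree] p = C (p.natDegree.factorial : ℝ) := by
  rw [eq_C_of_natDegree_eq_zero (p := derivative^[p.natDegree] p)
    (Nat.le_zero.1 ((natDegree_iterate_derivative _ _).trans (Nat.sub_self _).le)),
    coeff_iterate_derivative]
  simp [hp.coeff_natDegree, Nat.descFactorial_self]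

open Polynomial in
/-- A polynomial of degree `< n` cannot match, at points interlacing the roots of a polynomial `Q`
of degree `n`, the signs of `Q`. -/
theorem exists_eval_mul_eval_nonpos_of_interlacing {n : ℕ} {y : Fin (n + 2) → ℝ}
    (hy : StrictMono y) {p : ℝ[X]} (hp : p.degree < n) {ξ η : Fin (n + 1) → ℝ}
    (hξ : ∀ j, ξ j ∈ Ioo (y j.castSucc) (y j.succ))
    (hη : ∀ j, η j ∈ Ioo (y j.castSucc) (y j.succ)) :
    ∃ j, p.eval (ξ j) * (∏ i : Fin n, (X - C (y i.castSucc.succ))).eval (η j) ≤ 0 := by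
  by_contra! hpos
  have hmono : StrictMono ξ := fun i j hij =>
    ((hξ i).2.trans_le (hy.monotone (Fin.succ_le_castSucc_iff.2 hij))).trans (hξ j).1
  have hsum := Lagrange.coeff_eq_sum (s := Finset.univ) (v := ξ) hmono.injective.injOn (P := p)
    (hp.trans (by simp; norm_cast; omega))
  rw [coeff_eq_zero_of_degree_lt (by simpa using hp)] at hsum
  refine (Finset.sum_pos (fun j _ => ?_) Finset.univ_nonempty).ne hsum
  have hW : ∏ i ∈ Finset.univ.erase j, (ξ j - ξ i) = ∏ i : Fin n, (ξ j - ξ (j.succAbove i)) := by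
    rw [Fin.univ_succAbove n j, Finset.cons_eq_insert,
      Finset.erase_insert (by simp), Finset.prod_map]
    rfl
  have hQW : 0 < (∏ i : Fin n, (X - C (y i.castSucc.succ))).eval (η j) *
      ∏ i ∈ Finset.univ.erase j, (ξ j - ξ i) := by
    rw [hW, eval_prod, ← Finset.prod_mul_distrib]
    refine Finset.prod_pos fun i _ => ?_
    rw [eval_sub, eval_X, eval_C]
    rcases lt_or_ge i.castSucc j with h | h
    · rw [Fin.succAbove_of_castSucc_lt _ _ h]
      exact mul_pos (sub_pos.2 ((hy.monotone (Fin.succ_le_castSucc_iff.2 h)).trans_lt (hη j).1))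
        (sub_pos.2 (hmono h))
    · rw [Fin.succAbove_of_le_castSucc _ _ h]
      exact mul_pos_of_neg_of_neg
        (sub_neg.2 ((hη j).2.trans_le (hy.monotone (Fin.succ_le_succ_iff.2 h))))
        (sub_neg.2 (hmono (Fin.le_castSucc_iff.1 h)))
  have hW0 : ∏ i ∈ Finset.univ.erase j, (ξ j - ξ i) ≠ 0 := right_ne_zero_of_mul hQW.ne'
  have hQ0 := left_ne_zero_of_mul hQW.ne'
  rw [← mul_div_mul_left _ _ hQ0, mul_comm _ (p.eval _)]
  exact div_pos (hpos j) hQW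

open Polynomial in
/-- A function whose derivative is a monic polynomial with roots `y 1, …, y n` has a small increment
between two consecutive points among `y 0, …, y (n + 1)`. -/
theorem exists_abs_sub_mul_le_two {n : ℕ} {y : Fin (n + 2) → ℝ} (hy : StrictMono y)
    (hyI : ∀ i, y i ∈ Icc (-1 : ℝ) 1) {F : ℝ → ℝ}
    (hF : ∀ x, HasDerivAt F ((∏ i : Fin n, (X - C (y i.castSucc.succ))).eval x) x) :
    ∃ j : Fin (n + 1), |F (y j.succ) - F (y j.castSucc)| * ((n + 1) * 2 ^ n) ≤ 2 := by
  by_contra! hlt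
  set Q : ℝ[X] := ∏ i : Fin n, (X - C (y i.castSucc.succ)) with hQ
  set K : ℝ := (n + 1) * 2 ^ n with hK
  have hK0 : 0 < K := by positivity
  set T : ℝ[X] := Chebyshev.T ℝ (n + 1 : ℕ) with hT
  have hTdeg : T.natDegree = n + 1 := by rw [hT, Chebyshev.natDegree_T, Int.natAbs_natCast]
  have hTlead : T.coeff (n + 1) = 2 ^ n := by
    rw [← hTdeg, coeff_natDegree, hT, Chebyshev.leadingCoeff_T, Int.natAbs_natCast, Nat.add_sub_cancel]
  have hQm : Q.Monic := monic_prod_X_sub_C _ _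
  have hQdeg : Q.natDegree = n := by simp [hQ]
  have hdeg : (C K * Q - derivative T).degree < n := by
    rw [degree_lt_iff_coeff_zero]
    intro m hm
    rcases hm.eq_or_lt with rfl | hm
    · rw [coeff_sub, coeff_C_mul, coeff_derivative, hTlead, show Q.coeff n = 1 by
        rw [← hQdeg]; exact hQm.coeff_natDegree]
      rw [hK]; ring
    · rw [coeff_sub, coeff_C_mul, coeff_derivative, coeff_eq_zero_of_natDegree_lt (by omega),
        coeff_eq_zero_of_natDegree_lt (by omega)]
      ring
  have hmvt : ∀ j : Fin (n + 1), ∃ η ∈ Ioo (y j.castSucc) (y j.succ), ∃ ξ ∈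
      Ioo (y j.castSucc) (y j.succ), 0 < (C K * Q - derivative T).eval ξ * Q.eval η := by
    intro j
    have hab : y j.castSucc < y j.succ := hy j.castSucc_lt_succ
    have hG : ∀ x, HasDerivAt (fun t => K * F t - T.eval t)
        ((C K * Q - derivative T).eval x) x := fun x => by
      rw [eval_sub, eval_mul, eval_C]
      exact ((hF x).const_mul K).sub (T.hasDerivAt x)
    obtain ⟨η, hη, hηe⟩ := exists_hasDerivAt_eq_slope F _ hab
      (fun x _ => (hF x).continuousAt.continuousWithinAt) (fun x _ => hF x)
    obtain ⟨ξ, hξ, hξe⟩ := exists_hasDerivAt_eq_slope _ _ hab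
      (fun x _ => (hG x).continuousAt.continuousWithinAt) (fun x _ => hG x)
    refine ⟨η, hη, ξ, hξ, ?_⟩
    have h1 := Chebyshev.abs_eval_T_real_le_one (n + 1 : ℕ) (abs_le.2 (hyI j.castSucc))
    have h2 := Chebyshev.abs_eval_T_real_le_one (n + 1 : ℕ) (abs_le.2 (hyI j.succ))
    rw [← hT, abs_le] at h1 h2
    have hj := hlt j
    rw [hξe, hηe, div_mul_div_comm]
    refine div_pos ?_ (by nlinarith)
    rcases le_or_gt 0 (F (y j.succ) - F (y j.castSucc)) with h | h
    · rw [abs_of_nonneg h] at hj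
      exact mul_pos (by linarith) (by nlinarith)
    · rw [abs_of_neg h] at hj
      exact mul_pos_of_neg_of_neg (by linarith) h
  choose η hη ξ hξ hpos using hmvt
  obtain ⟨j, hj⟩ := exists_eval_mul_eval_nonpos_of_interlacing hy hdeg hξ hη
  exact (hpos j).not_ge hj

open Polynomial in
/-- If `f` has `n + 2` critical points in `[-1, 1]` with consecutive critical values more than `δ`
apart, then its `(n + 1)`-st derivative is large. -/
theorem mul_factorial_le_of_critical_points {n : ℕ} {f : ℝ → ℝ}
    (hf : ContDiffOn ℝ (n + 1 : ℕ) f (Icc (-1 : ℝ) 1)) {B δ : ℝ}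
    (hB : ∀ x ∈ Icc (-1 : ℝ) 1, |iteratedDerivWithin (n + 1) f (Icc (-1 : ℝ) 1) x| ≤ B)
    {y : Fin (n + 2) → ℝ} (hy : StrictMono y) (hyI : ∀ i, y i ∈ Icc (-1 : ℝ) 1)
    (hcrit : ∀ i, derivWithin f (Icc (-1 : ℝ) 1) (y i) = 0)
    (hδ : ∀ j : Fin (n + 1), δ < |f (y j.succ) - f (y j.castSucc)|) :
    δ * 2 ^ n * (n + 1).factorial ≤ 2 * B := by
  set I : Set ℝ := Icc (-1 : ℝ) 1 with hI
  have hU : UniqueDiffOn ℝ I := uniqueDiffOn_Icc (by norm_num)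
  set Q : ℝ[X] := ∏ i : Fin n, (X - C (y i.castSucc.succ)) with hQ
  have hQm : Q.Monic := monic_prod_X_sub_C _ _
  have hQdeg : Q.natDegree = n := by simp [hQ]
  have hQroot : ∀ x, Q.eval x = 0 ↔ ∃ i : Fin n, x = y i.castSucc.succ := fun x => by
    simp [hQ, eval_prod, Finset.prod_eq_zero_iff, sub_eq_zero]
  let F : ℝ → ℝ := fun x => ∫ t in (0 : ℝ)..x, Q.eval t
  have hF : ∀ x, HasDerivAt F (Q.eval x) x := fun x =>
    (Q.continuous.integral_hasStrictDerivAt 0 x).hasDerivAt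
  obtain ⟨j, hj⟩ := exists_abs_sub_mul_le_two hy hyI hF
  set a := y j.castSucc
  set b := y j.succ
  have hab : a < b := hy j.castSucc_lt_succ
  have hIcc : Icc a b ⊆ I := Icc_subset_Icc (hyI _).1 (hyI _).2
  obtain ⟨ξ, hξ, hξe⟩ := exists_ratio_hasDerivAt_eq_ratio_slope f (derivWithin f I) hab
    (hf.continuousOn.mono hIcc)
    (fun x hx => ((hf.differentiableOn (by simp)) x
      (hIcc (Ioo_subset_Icc_self hx))).hasDerivWithinAt.hasDerivAt
      (Filter.mem_of_superset (Icc_mem_nhds hx.1 hx.2) hIcc))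
    F _ (fun x _ => (hF x).continuousAt.continuousWithinAt) (fun x _ => hF x)
  have hf' : ContDiffOn ℝ n (derivWithin f I) I := hf.derivWithin hU (by norm_cast)
  have hξy : ∀ i, ξ ≠ y i := by
    rintro i rfl
    have h1 : j.castSucc < i := hy.lt_iff_lt.1 hξ.1
    have h2 : i < j.succ := hy.lt_iff_lt.1 hξ.2
    exact (Fin.castSucc_lt_iff_succ_le.1 h1).not_gt h2
  have hyinj : Function.Injective fun i : Fin n => y i.castSucc.succ :=
    hy.injective.comp ((Fin.succ_injective _).comp (Fin.castSucc_injective _))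
  have hP : ContDiff ℝ n fun t => Q.eval t := by
    simpa using Q.contDiff_aeval (𝕜 := ℝ) n
  have hf1 := contDiffOn_const (c := F b - F a) |>.mul hf'
  have hg1 := contDiffOn_const (c := f b - f a) |>.mul (hP.contDiffOn (s := I))
  obtain ⟨ζ, hζ, hζ0⟩ := exists_iteratedDerivWithin_eq_zero_s6 (by norm_num) (hf1.sub hg1)
    (s := insert ξ (Finset.univ.image fun i : Fin n => y i.castSucc.succ))
    (by
      rw [Finset.card_insert_of_notMem (by simpa using fun i : Fin n => (hξy i.castSucc.succ).symm),
        Finset.card_image_of_injective _ hyinj]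
      simp)
    (by
      simp only [Finset.mem_insert, Finset.mem_image, Finset.mem_univ, true_and]
      rintro x (rfl | ⟨i, rfl⟩)
      · exact hIcc (Ioo_subset_Icc_self hξ)
      · exact hyI _)
    (by
      simp only [Finset.mem_insert, Finset.mem_image, Finset.mem_univ, true_and]
      rintro x (rfl | ⟨i, rfl⟩)
      · exact sub_eq_zero.2 hξe
      · rw [hcrit, (hQroot _).2 ⟨i, rfl⟩]; simp)
  have hder : iteratedDerivWithin n (fun x => (F b - F a) * derivWithin f I x -
      (f b - f a) * Q.eval x) I ζ = (F b - F a) * iteratedDerivWithin (n + 1) f I ζ -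
        (f b - f a) * n.factorial := by
    have hsub := iteratedDerivWithin_sub hζ hU (hf1 ζ hζ) (hg1 ζ hζ)
    rw [iteratedDerivWithin_const_mul_field, iteratedDerivWithin_const_mul_field,
      iteratedDerivWithin_polynomial_eval_s6 hU Q n hζ, ← iteratedDerivWithin_succ'] at hsub
    have hQn := iterate_derivative_of_monic hQm
    rw [hQdeg] at hQn
    rw [hQn, eval_C] at hsub
    exact hsub
  rw [hder, sub_eq_zero] at hζ0
  have habs : |f b - f a| * n.factorial ≤ |F b - F a| * B := by
    rw [← abs_of_nonneg (Nat.cast_nonneg' n.factorial : (0 : ℝ) ≤ _), ← abs_mul, ← hζ0, abs_mul]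
    exact mul_le_mul_of_nonneg_left (hB ζ hζ) (abs_nonneg _)
  have hB0 : 0 ≤ B := (abs_nonneg _).trans (hB ζ hζ)
  calc δ * 2 ^ n * (n + 1).factorial
      ≤ |f b - f a| * 2 ^ n * (n + 1).factorial := by gcongr; exact (hδ j).le
    _ = |f b - f a| * n.factorial * ((n + 1) * 2 ^ n) := by
      rw [Nat.factorial_succ]; push_cast; ring
    _ ≤ |F b - F a| * B * ((n + 1) * 2 ^ n) := by gcongr
    _ = |F b - F a| * ((n + 1) * 2 ^ n) * B := by ring
    _ ≤ 2 * B := by gcongr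

/-- A set which is bounded below and needs more than `k` intervals of radius `ε` to be covered
contains `k + 1` points with mutual distances greater than `2 * ε`. -/
theorem exists_separated_of_not_covered {ε : ℝ} (hε : 0 < ε) {k : ℕ} {S : Set ℝ} (hS : BddBelow S)
    (hcov : ∀ t : Finset ℝ, t.card ≤ k → ¬ S ⊆ ⋃ c ∈ t, Metric.closedBall c ε) :
    ∃ v : Fin (k + 1) → ℝ, (∀ i, v i ∈ S) ∧ ∀ i j, i < j → v i + 2 * ε < v j := by
  induction k generalizing S with
  | zero =>
    have hne : S.Nonempty := by
      rw [Set.nonempty_iff_ne_empty]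
      rintro rfl
      exact hcov ∅ (by simp) (empty_subset _)
    obtain ⟨x, hx⟩ := hne
    exact ⟨fun _ => x, fun _ => hx, fun i j hij => absurd hij (by omega)⟩
  | succ k ih =>
    have hne : S.Nonempty := by
      rw [Set.nonempty_iff_ne_empty]
      rintro rfl
      exact hcov ∅ (by simp) (empty_subset _)
    obtain ⟨v, hvS, hv⟩ := ih (S := S ∩ Ioi (sInf S + 2 * ε)) (hS.mono inter_subset_left) (by
      intro t ht hsub
      refine hcov (insert (sInf S + ε) t)
        ((Finset.card_insert_le _ _).trans (Nat.succ_le_succ ht)) fun x hx => ?_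
      rw [Finset.set_biUnion_insert]
      rcases le_or_gt x (sInf S + 2 * ε) with h | h
      · left
        rw [Metric.mem_closedBall, Real.dist_eq, abs_le]
        have := csInf_le hS hx
        constructor <;> linarith
      · exact Or.inr (hsub ⟨hx, h⟩))
    have h0 : sInf S < v 0 - 2 * ε := by
      have : sInf S + 2 * ε < v 0 := (hvS 0).2
      linarith
    obtain ⟨x, hx, hxv⟩ := exists_lt_of_csInf_lt hne h0
    have hle : ∀ i, v 0 ≤ v i := fun i => by
      rcases (Fin.zero_le i).eq_or_lt with h | h
      · rw [h]
      · linarith [hv 0 i h]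
    refine ⟨Fin.cons x v, Fin.cases hx fun i => (hvS i).1, fun i j hij => ?_⟩
    cases j using Fin.cases with
    | zero => exact absurd hij (Fin.not_lt_zero i)
    | succ j =>
      cases i using Fin.cases with
      | zero => simpa using by linarith [hle j]
      | succ i => simpa using hv i j (Fin.succ_lt_succ_iff.1 hij)

theorem exists_separated_of_lt_coveringNumber {ε : ℝ} (hε : 0 < ε) {k : ℕ} {S : Set ℝ}
    (hS : BddBelow S) (hk : k < coveringNumber ε S) :
    ∃ v : Fin (k + 1) → ℝ, (∀ i, v i ∈ S) ∧ ∀ i j, i < j → v i + 2 * ε < v j :=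
  exists_separated_of_not_covered hε hS fun t ht hsub =>
    (Nat.sInf_le ⟨t, rfl, hsub⟩ : coveringNumber ε S ≤ t.card).not_gt (ht.trans_lt hk)

/-- A function with large covering number of its critical values has many critical points with
separated critical values. -/
theorem exists_critical_points_of_lt_coveringNumber {ε : ℝ} (hε : 0 < ε) {k : ℕ} {f : ℝ → ℝ}
    (hf : ContinuousOn f (Icc (-1 : ℝ) 1)) (hk : k < coveringNumber ε (critValues1 f)) :
    ∃ y : Fin (k + 1) → ℝ, StrictMono y ∧ (∀ i, y i ∈ Icc (-1 : ℝ) 1) ∧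
      (∀ i, derivWithin f (Icc (-1 : ℝ) 1) (y i) = 0) ∧
      ∀ i j, i ≠ j → 2 * ε < |f (y j) - f (y i)| := by
  have hbdd : BddBelow (critValues1 f) :=
    (isCompact_Icc.image_of_continuousOn hf).bddBelow.mono (image_mono fun x hx => hx.1)
  obtain ⟨v, hvS, hv⟩ := exists_separated_of_lt_coveringNumber hε hbdd hk
  choose x hx hxv using hvS
  have hsep : ∀ i j, i ≠ j → 2 * ε < |f (x j) - f (x i)| := by
    intro i j hij
    rw [hxv, hxv]
    rcases hij.lt_or_gt with h | h
    · exact lt_of_lt_of_le (by linarith [hv i j h]) (le_abs_self _)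
    · exact lt_of_lt_of_le (by linarith [hv j i h]) (neg_le_abs _)
  have hinj : Function.Injective x := fun i j hij => by
    by_contra hne
    have := hsep i j hne
    rw [hij, sub_self, abs_zero] at this
    linarith
  have hcard : (Finset.univ.image x).card = k + 1 := by
    simp [Finset.card_image_of_injective _ hinj]
  let y := (Finset.univ.image x).orderEmbOfFin hcard
  have hy : ∀ i, ∃ l, x l = y i := fun i => by
    obtain ⟨l, -, hl⟩ := Finset.mem_image.1 ((Finset.univ.image x).orderEmbOfFin_mem hcard i)
    exact ⟨l, hl⟩
  choose σ hσ using hy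
  refine ⟨y, y.strictMono, fun i => hσ i ▸ (hx _).1, fun i => hσ i ▸ (hx _).2, fun i j hij => ?_⟩
  rw [← hσ, ← hσ]
  refine hsep _ _ fun h => hij (y.injective ?_)
  rw [← hσ, ← hσ, h]

theorem one_add_one_div_pow_le_two_pow (n : ℕ) :
    (1 + 1 / ((n + 2 : ℕ) + 1 : ℝ)) ^ (n + 2) ≤ 2 ^ (n + 1) := by
  have h1 : (1 + 1 / ((n + 2 : ℕ) + 1 : ℝ)) ≤ 4 / 3 := by
    have : 1 / ((n + 2 : ℕ) + 1 : ℝ) ≤ 1 / 3 :=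
      one_div_le_one_div_of_le (by norm_num) (by push_cast; linarith [n.cast_nonneg (α := ℝ)])
    linarith
  calc (1 + 1 / ((n + 2 : ℕ) + 1 : ℝ)) ^ (n + 2) ≤ (4 / 3) ^ (n + 2) := by gcongr
    _ = (4 / 3) ^ n * (16 / 9) := by ring
    _ ≤ 2 ^ n * 2 := by gcongr <;> norm_num
    _ = 2 ^ (n + 1) := by ring

theorem abs_iteratedDerivWithin_le_factorial_mul_taylorConst1 {d : ℕ} {f : ℝ → ℝ}
    (hf : ContDiffOn ℝ d f (Icc (-1 : ℝ) 1)) {x : ℝ} (hx : x ∈ Icc (-1 : ℝ) 1) :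
    |iteratedDerivWithin d f (Icc (-1 : ℝ) 1) x| ≤ d.factorial * taylorConst1 d f := by
  have hcont := (hf.continuousOn_iteratedDerivWithin le_rfl
    (uniqueDiffOn_Icc (by norm_num : (-1 : ℝ) < 1))).abs
  obtain ⟨C, hC⟩ := (isCompact_Icc.image_of_continuousOn hcont).bddAbove
  have hC' : ∀ z ∈ Icc (-1 : ℝ) 1, |iteratedDerivWithin d f (Icc (-1 : ℝ) 1) z| ≤ C :=
    fun z hz => hC ⟨z, hz, rfl⟩
  have hC0 : 0 ≤ C := (abs_nonneg _).trans (hC' x hx)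
  rw [taylorConst1, ← mul_assoc, mul_one_div_cancel (by positivity), one_mul]
  have hb : BddAbove (range fun z => ⨆ _ : z ∈ Icc (-1 : ℝ) 1,
      |iteratedDerivWithin d f (Icc (-1 : ℝ) 1) z|) :=
    ⟨C, forall_mem_range.2 fun z => Real.iSup_le (hC' z) hC0⟩
  refine le_ciSup_of_le hb x ?_
  rw [ciSup_pos hx]

/-- Corollary 3.2: if the critical values of a C^d function on
[-1,1] need at least d+2 intervals of radius ε₀ to be covered, then
`R_d(f) ≥ (1 + 1/(d+1))^d · ε₀ > 0`. -/
theorem stmt_6 (d : ℕ) (hd : 1 ≤ d) (f : ℝ → ℝ)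
    (hf : ContDiffOn ℝ d f (Icc (-1 : ℝ) 1))
    (ε₀ : ℝ) (hε₀ : 0 < ε₀)
    (hM : d + 2 ≤ coveringNumber ε₀ (critValues1 f)) :
    taylorConst1 d f ≥ (1 + 1 / ((d : ℝ) + 1)) ^ d * ε₀ ∧
      0 < (1 + 1 / ((d : ℝ) + 1)) ^ d * ε₀ := by
  refine ⟨?_, by positivity⟩
  obtain ⟨y, hy, hyI, hcrit, hsep⟩ :=
    exists_critical_points_of_lt_coveringNumber hε₀ hf.continuousOn hM
  have hB := fun x => abs_iteratedDerivWithin_le_factorial_mul_taylorConst1 hf (x := x)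
  obtain _ | _ | n := d
  · omega
  · have hmvt : ∀ i j : Fin 3, i < j → |f (y j) - f (y i)| ≤ taylorConst1 1 f * (y j - y i) := by
      intro i j hij
      have h := (convex_Icc (-1 : ℝ) 1).norm_image_sub_le_of_norm_derivWithin_le
        (C := taylorConst1 1 f) (hf.differentiableOn (by simp))
        (fun x hx => by simpa using hB x hx) (hyI i) (hyI j)
      rwa [Real.norm_eq_abs, Real.norm_eq_abs, abs_of_pos (sub_pos.2 (hy hij))] at h
    have h01 := (hsep 0 1 (by decide)).trans_le (hmvt 0 1 (by decide))
    have h12 := (hsep 1 2 (by decide)).trans_le (hmvt 1 2 (by decide))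
    have hlen : y 2 - y 0 ≤ 2 := by linarith [(hyI 2).2, (hyI 0).1]
    have hR : 0 ≤ taylorConst1 1 f := by
      simpa using (abs_nonneg _).trans (hB _ (hyI 0))
    norm_num
    nlinarith
  · have h := mul_factorial_le_of_critical_points (δ := 2 * ε₀) hf hB
      (hy.comp Fin.strictMono_castSucc) (fun i => hyI _) (fun i => hcrit _)
      (fun j => hsep _ _ fun h => j.castSucc_lt_succ.ne (Fin.castSucc_injective _ h))
    have hfac : (0 : ℝ) < (n + 1 + 1).factorial := by positivity
    have hle : 2 ^ (n + 1) * ε₀ ≤ taylorConst1 (n + 1 + 1) f :=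
      le_of_mul_le_mul_left (by linarith) hfac
    refine le_trans ?_ hle
    exact mul_le_mul_of_nonneg_right (one_add_one_div_pow_le_two_pow n) hε₀.le
end

section
/- Let f : [-1,1] → ℝ be a C^5 function with set of critical values Δ = f({x ∈ [-1,1] : f'(x) = 0}), and let R_5(f) = (1/5!) · sup_{x∈[-1,1]} |f^{(5)}(x)|. If ε₀ > 0 is such that the covering number satisfies M(ε₀, Δ) ≥ 7, then R_5(f) ≥ (7/6)^5 · ε₀ > 0. -/
open Set

/-- The Taylor constant `R_5(f) = (1/5!) · sup_{x ∈ [-1,1]} |f^{(5)}(x)|`. -/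
noncomputable def taylorConst5 (f : ℝ → ℝ) : ℝ :=
  (1 / (Nat.factorial 5)) *
    ⨆ x ∈ Icc (-1 : ℝ) 1, |iteratedDerivWithin 5 f (Icc (-1 : ℝ) 1) x|

/-- **Generalized Rolle theorem** for a chain `G 0, G 1, …, G n` of successive derivatives. -/
theorem exists_chain_eq_zero_of_card_zeros {p q : ℝ} (n : ℕ) (G : ℕ → ℝ → ℝ)
    (hG : ∀ k < n, ∀ x ∈ Icc p q, HasDerivWithinAt (G k) (G (k + 1) x) (Icc p q) x)
    (T : Finset ℝ) (hT : ↑T ⊆ Icc p q) (hcard : T.card = n + 1) (hzero : ∀ c ∈ T, G 0 c = 0) :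
    ∃ ξ ∈ Icc p q, G n ξ = 0 := by
  induction n generalizing G T with
  | zero =>
    obtain ⟨c, hc⟩ := Finset.card_pos.mp (by omega : 0 < T.card)
    exact ⟨c, hT hc, hzero c hc⟩
  | succ n ih =>
    set u := T.orderEmbOfFin hcard
    have hu : ∀ i, u i ∈ T := T.orderEmbOfFin_mem hcard
    have rolle : ∀ i : Fin (n + 1), ∃ c ∈ Ioo (u i.castSucc) (u i.succ), G 1 c = 0 := by
      intro i
      have hsub : Icc (u i.castSucc) (u i.succ) ⊆ Icc p q :=
        Icc_subset_Icc (hT (hu _)).1 (hT (hu _)).2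
      refine exists_hasDerivAt_eq_zero (f := G 0) (u.strictMono i.castSucc_lt_succ)
        (fun x hx => ((hG 0 (by omega) x (hsub hx)).continuousWithinAt).mono hsub)
        ((hzero _ (hu _)).trans (hzero _ (hu _)).symm) fun x hx => ?_
      exact (hG 0 (by omega) x (hsub (Ioo_subset_Icc_self hx))).hasDerivAt
        (Filter.mem_of_superset (Icc_mem_nhds hx.1 hx.2) hsub)
    choose ξ hξ hξ0 using rolle
    have hmono : StrictMono ξ := by
      refine Fin.strictMono_iff_lt_succ.mpr fun i => (hξ _).2.trans ?_
      simpa using (hξ i.succ).1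
    refine ih (fun k => G (k + 1)) (fun k hk => hG (k + 1) (by omega))
      (Finset.univ.image ξ) ?_ ?_ ?_
    · intro x hx
      simp only [Finset.coe_image, Finset.coe_univ, image_univ, mem_range] at hx
      obtain ⟨i, rfl⟩ := hx
      exact ⟨(hT (hu _)).1.trans (hξ i).1.le, (hξ i).2.le.trans (hT (hu _)).2⟩
    · simp [Finset.card_image_of_injective _ hmono.injective]
    · simpa using hξ0

open Polynomial in
/-- A function vanishing at `n` nodes is bounded by `K / n!` times the node polynomial, where `K`
bounds its `n`-th derivative. -/
theorem abs_le_of_zeros {p q K : ℝ} (n : ℕ) (G : ℕ → ℝ → ℝ)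
    (hG : ∀ k < n, ∀ x ∈ Icc p q, HasDerivWithinAt (G k) (G (k + 1) x) (Icc p q) x)
    (hK : ∀ x ∈ Icc p q, |G n x| ≤ K)
    (T : Finset ℝ) (hT : ↑T ⊆ Icc p q) (hcard : T.card = n) (hzero : ∀ c ∈ T, G 0 c = 0)
    {x : ℝ} (hx : x ∈ Icc p q) :
    |G 0 x| ≤ K / n.factorial * ∏ c ∈ T, |x - c| := by
  have hK0 : 0 ≤ K := (abs_nonneg _).trans (hK x hx)
  by_cases hxT : x ∈ T
  · rw [hzero x hxT, abs_zero]
    exact mul_nonneg (by positivity) (Finset.prod_nonneg fun _ _ => abs_nonneg _)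
  set W : ℝ[X] := ∏ c ∈ T, (X - C c) with hW
  have hWeval : ∀ t, W.eval t = ∏ c ∈ T, (t - c) := fun t => by simp [hW, eval_prod]
  have hWn : derivative^[n] W = C (n.factorial : ℝ) := by
    rw [hW, iterate_derivative_prod_X_sub_C hcard.ge, hcard]
    simp [← hcard]
  obtain ⟨ξ, hξ, hξ0⟩ := exists_chain_eq_zero_of_card_zeros n
    (fun k t => G k t * W.eval x - G 0 x * (derivative^[k] W).eval t)
    (fun k hk t ht => by
      simp only [Function.iterate_succ_apply']
      exact ((hG k hk t ht).mul_const _).sub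
        (((derivative^[k] W).hasDerivAt t).hasDerivWithinAt.const_mul _))
    (insert x T) (by
      rw [Finset.coe_insert]
      exact insert_subset hx hT)
    (by rw [Finset.card_insert_of_notMem hxT, hcard])
    (by
      intro c hc
      rcases Finset.mem_insert.mp hc with rfl | hc
      · simp
      · have : W.eval c = 0 := by
          rw [hWeval]
          exact Finset.prod_eq_zero hc (sub_self c)
        simp [hzero c hc, this])
  have hfac : (0 : ℝ) < n.factorial := by positivity
  rw [hWn, eval_C, sub_eq_zero] at hξ0
  have habs : |G 0 x| * n.factorial = |G n ξ| * ∏ c ∈ T, |x - c| := by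
    rw [← Finset.abs_prod, ← hWeval, ← abs_mul, hξ0, abs_mul, abs_of_pos hfac]
  rw [div_mul_eq_mul_div, le_div_iff₀ hfac, habs]
  exact mul_le_mul_of_nonneg_right (hK ξ hξ) (Finset.prod_nonneg fun _ _ => abs_nonneg _)

/-- If every cover of `f '' Z` by `ε`-balls has at least `n` balls, then there are `n` points of `Z`
whose images are pairwise more than `ε` apart. -/
theorem exists_separated_of_le_coveringNumber {α : Type*} {f : α → ℝ} {Z : Set α} {ε : ℝ} {n : ℕ}
    (hε : 0 ≤ ε) (hn : n ≤ coveringNumber ε (f '' Z)) :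
    ∃ s : Finset α, ↑s ⊆ Z ∧ s.card = n ∧ (s : Set α).Pairwise fun a b => ε < |f a - f b| := by
  classical
  induction n with
  | zero => exact ⟨∅, by simp, by simp, by simp⟩
  | succ n ih =>
    obtain ⟨s, hsZ, hcard, hsep⟩ := ih (by omega)
    have hnot : ¬ f '' Z ⊆ ⋃ c ∈ s.image f, Metric.closedBall c ε := fun hcov => by
      have h1 : coveringNumber ε (f '' Z) ≤ (s.image f).card := Nat.sInf_le ⟨_, rfl, hcov⟩
      have h2 : (s.image f).card ≤ s.card := Finset.card_image_le
      omega
    obtain ⟨_, ⟨z, hz, rfl⟩, hzs⟩ := not_subset.mp hnot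
    simp only [Finset.mem_image, mem_iUnion, Metric.mem_closedBall, Real.dist_eq, not_exists,
      not_le] at hzs
    have hfar : ∀ a ∈ s, ε < |f z - f a| := fun a ha => hzs _ ⟨a, ha, rfl⟩
    have hzmem : z ∉ s := fun h => by
      have := hfar z h
      rw [sub_self, abs_zero] at this
      linarith
    refine ⟨insert z s, ?_, by rw [Finset.card_insert_of_notMem hzmem, hcard], ?_⟩
    · rw [Finset.coe_insert]
      exact insert_subset hz hsZ
    · rw [Finset.coe_insert]
      refine hsep.insert fun b hb _ => ⟨hfar b hb, ?_⟩
      rw [abs_sub_comm]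
      exact hfar b hb

/-- Among `n + 2` points of an interval, two are at distance at most its length over `n + 1`. -/
theorem exists_lt_sub_le_of_card {p q : ℝ} {n : ℕ} (s : Finset ℝ) (hs : ↑s ⊆ Icc p q)
    (hcard : s.card = n + 2) : ∃ a ∈ s, ∃ b ∈ s, a < b ∧ b - a ≤ (q - p) / (n + 1) := by
  set u := s.orderEmbOfFin hcard
  have hu : ∀ i, u i ∈ s := s.orderEmbOfFin_mem hcard
  by_contra! h
  have hgap : ∀ i : Fin (n + 1), (q - p) / (n + 1) < u i.succ - u i.castSucc := fun i =>
    h _ (hu _) _ (hu _) (u.strictMono i.castSucc_lt_succ)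
  have hsum := Finset.sum_lt_sum_of_nonempty (Finset.univ_nonempty (α := Fin (n + 1)))
    fun i _ => hgap i
  have htel : ∑ i : Fin (n + 1), (u i.succ - u i.castSucc) = u (Fin.last _) - u 0 := by
    rw [Finset.sum_sub_distrib]
    have h1 := Fin.sum_univ_succ (fun i => u i)
    have h2 := Fin.sum_univ_castSucc (fun i => u i)
    linarith
  rw [htel, Finset.sum_const, Finset.card_univ, Fintype.card_fin, nsmul_eq_mul] at hsum
  push_cast at hsum
  rw [mul_div_cancel₀ _ (by positivity)] at hsum
  linarith [(hs (hu 0)).1, (hs (hu (Fin.last _))).2]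

/-- The Taylor constant of a `C^5` function controls its fifth derivative. -/
theorem abs_iteratedDerivWithin_le_taylorConst5 {f : ℝ → ℝ}
    (hf : ContDiffOn ℝ 5 f (Icc (-1 : ℝ) 1)) {x : ℝ} (hx : x ∈ Icc (-1 : ℝ) 1) :
    |iteratedDerivWithin 5 f (Icc (-1 : ℝ) 1) x| ≤ 120 * taylorConst5 f := by
  have hcont : ContinuousOn (fun x => |iteratedDerivWithin 5 f (Icc (-1 : ℝ) 1) x|)
      (Icc (-1 : ℝ) 1) :=
    (hf.continuousOn_iteratedDerivWithin le_rfl (uniqueDiffOn_Icc (by norm_num))).abs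
  obtain ⟨B, hB⟩ := isCompact_Icc.bddAbove_image hcont
  have hbdd : BddAbove (range fun x : ℝ =>
      ⨆ _ : x ∈ Icc (-1 : ℝ) 1, |iteratedDerivWithin 5 f (Icc (-1 : ℝ) 1) x|) := by
    refine ⟨max B 0, ?_⟩
    rintro _ ⟨y, rfl⟩
    by_cases hy : y ∈ Icc (-1 : ℝ) 1
    · simpa only [hy, ciSup_unique] using (hB (mem_image_of_mem _ hy)).trans (le_max_left _ _)
    · simp [hy]
  have hle := le_ciSup hbdd x
  simp only [hx, ciSup_unique] at hle
  have h5 : ((Nat.factorial 5 : ℕ) : ℝ) = 120 := by norm_num [Nat.factorial]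
  rw [taylorConst5, h5]
  linarith

/-- Corollary 3.3: if the critical values of a C^5 function on
[-1,1] need at least 7 intervals of radius ε₀ to be covered, then
`R_5(f) ≥ (7/6)^5 · ε₀ > 0`. -/
theorem stmt_7 (f : ℝ → ℝ)
    (hf : ContDiffOn ℝ 5 f (Icc (-1 : ℝ) 1))
    (ε₀ : ℝ) (hε₀ : 0 < ε₀)
    (hM : 7 ≤ coveringNumber ε₀ (critValues1 f)) :
    taylorConst5 f ≥ ((7 : ℝ) / 6) ^ 5 * ε₀ ∧ 0 < ((7 : ℝ) / 6) ^ 5 * ε₀ := by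
  refine ⟨?_, by positivity⟩
  obtain ⟨s, hsZ, hcard, hsep⟩ := exists_separated_of_le_coveringNumber hε₀.le hM
  have hsI : ↑s ⊆ Icc (-1 : ℝ) 1 := fun x hx => (hsZ hx).1
  obtain ⟨a, ha, b, hb, hab, hgap⟩ := exists_lt_sub_le_of_card (n := 5) s hsI hcard
  obtain ⟨T, hTs, hTcard⟩ : ∃ T ⊆ s \ {a, b}, T.card = 2 :=
    Finset.exists_subset_card_eq (by
      have := Finset.le_card_sdiff {a, b} s
      have := Finset.card_le_two (a := a) (b := b)
      omega)
  obtain ⟨haT, hbT⟩ : a ∉ T ∧ b ∉ T :=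
    ⟨fun h => by simpa using hTs h, fun h => by simpa using hTs h⟩
  have hTs' : T ⊆ s := hTs.trans Finset.sdiff_subset
  have hnodes : insert a (insert b T) ⊆ s :=
    Finset.insert_subset ha (Finset.insert_subset hb hTs')
  have haT' : a ∉ insert b T := by simp [hab.ne, haT]
  have hder : ∀ k < 5, ∀ x ∈ Icc (-1 : ℝ) 1, HasDerivWithinAt
      (iteratedDerivWithin k f (Icc (-1) 1)) (iteratedDerivWithin (k + 1) f (Icc (-1) 1) x)
      (Icc (-1) 1) x := fun k hk x hx => by
    rw [iteratedDerivWithin_succ]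
    exact (hf.differentiableOn_iteratedDerivWithin (by exact_mod_cast hk)
      (uniqueDiffOn_Icc (by norm_num)) x hx).hasDerivWithinAt
  have hR : 0 ≤ 120 * taylorConst5 f :=
    (abs_nonneg _).trans (abs_iteratedDerivWithin_le_taylorConst5 hf (hsI ha))
  have hsub : Icc a b ⊆ Icc (-1 : ℝ) 1 := Icc_subset_Icc (hsI ha).1 (hsI hb).2
  have hbound : ∀ x ∈ Icc a b, ‖iteratedDerivWithin 1 f (Icc (-1) 1) x‖ ≤
      120 * taylorConst5 f / 24 * (1 / 9) := by
    intro x hx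
    have h := abs_le_of_zeros 4 (fun k => iteratedDerivWithin (k + 1) f (Icc (-1) 1))
      (fun k hk => hder (k + 1) (by omega))
      (fun y hy => abs_iteratedDerivWithin_le_taylorConst5 hf hy)
      (insert a (insert b T)) (fun y hy => hsI (hnodes hy))
      (by rw [Finset.card_insert_of_notMem haT', Finset.card_insert_of_notMem hbT, hTcard])
      (fun c hc => by
        rw [zero_add, iteratedDerivWithin_one]
        exact (hsZ (hnodes hc)).2) (hsub hx)
    refine h.trans ?_
    have hprod : ∏ c ∈ T, |x - c| ≤ 4 := by
      calc ∏ c ∈ T, |x - c| ≤ ∏ _c ∈ T, (2 : ℝ) :=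
            Finset.prod_le_prod (fun _ _ => abs_nonneg _) fun c hc => by
              have h1 := hsub hx
              have h2 := hsI (hTs' hc)
              rw [abs_le]
              constructor <;> linarith [h1.1, h1.2, h2.1, h2.2]
        _ = 4 := by rw [Finset.prod_const, hTcard]; norm_num
    have hpair : |x - a| * |x - b| ≤ 1 / 36 := by
      rw [abs_of_nonneg (by linarith [hx.1]), abs_of_nonpos (by linarith [hx.2])]
      have hg : b - a ≤ 1 / 3 := by norm_num at hgap; linarith
      nlinarith [sq_nonneg (x - a - (b - x))]
    rw [Finset.prod_insert haT', Finset.prod_insert hbT, ← mul_assoc |x - a|]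
    have h4 : ((Nat.factorial 4 : ℕ) : ℝ) = 24 := by norm_num [Nat.factorial]
    rw [h4]
    refine mul_le_mul_of_nonneg_left ?_ (by positivity)
    calc |x - a| * |x - b| * ∏ c ∈ T, |x - c| ≤ 1 / 36 * 4 := by gcongr
      _ = 1 / 9 := by norm_num
  have hvar := (convex_Icc a b).norm_image_sub_le_of_norm_hasDerivWithin_le
    (fun x hx => (hder 0 (by omega) x (hsub hx)).mono hsub) hbound
    (left_mem_Icc.mpr hab.le) (right_mem_Icc.mpr hab.le)
  rw [iteratedDerivWithin_zero, Real.norm_eq_abs, Real.norm_eq_abs,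
    abs_of_pos (sub_pos.mpr hab)] at hvar
  have hlt := hsep hb ha hab.ne'
  norm_num at hgap ⊢
  nlinarith
end

section
/- Let α < 0 be a real number and let d be an integer with d > 1 − α. Then there is no C^d function f : [-1,1] → ℝ such that Δ_α = {m^α : m ∈ ℕ, m ≥ 1} is contained in the set of critical values f({x ∈ [-1,1] : f'(x) = 0}) of f. -/
open Set

/-- A function with `n + 1` zeros in an order-connected set has a derivative with `n` zeros in it. -/
theorem exists_finset_zeros_derivWithin {s J : Set ℝ} (hJs : J ⊆ s) (hJ : J.OrdConnected)
    {g : ℝ → ℝ} (hg : ContinuousOn g s) {n : ℕ} {T : Finset ℝ} (hTJ : ↑T ⊆ J)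
    (hT : T.card = n + 1) (hz : ∀ t ∈ T, g t = 0) :
    ∃ T' : Finset ℝ, ↑T' ⊆ J ∧ T'.card = n ∧ ∀ t ∈ T', derivWithin g s t = 0 := by
  classical
  set e := T.orderEmbOfFin hT
  have heT : ∀ i, e i ∈ T := fun i => T.orderEmbOfFin_mem hT i
  have key : ∀ i : Fin n, ∃ c ∈ Ioo (e i.castSucc) (e i.succ), derivWithin g s c = 0 := by
    intro i
    have hlt : e i.castSucc < e i.succ := e.strictMono Fin.castSucc_lt_succ
    have hsub : Icc (e i.castSucc) (e i.succ) ⊆ s :=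
      (hJ.out (hTJ (heT _)) (hTJ (heT _))).trans hJs
    obtain ⟨c, hc, hc0⟩ := exists_deriv_eq_zero hlt (hg.mono hsub)
      ((hz _ (heT _)).trans (hz _ (heT _)).symm)
    refine ⟨c, hc, ?_⟩
    rw [derivWithin_of_mem_nhds (Filter.mem_of_superset (Icc_mem_nhds hc.1 hc.2) hsub), hc0]
  choose c hc hc0 using key
  have hmono : StrictMono c := by
    intro i j hij
    have : e i.succ ≤ e j.castSucc := e.monotone (Fin.succ_le_castSucc_iff.2 hij)
    exact (hc i).2.trans_le (this.trans (hc j).1.le)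
  refine ⟨Finset.univ.image c, ?_, ?_, ?_⟩
  · intro x hx
    simp only [Finset.coe_image, Finset.coe_univ, image_univ, mem_range] at hx
    obtain ⟨i, rfl⟩ := hx
    exact hJ.out (hTJ (heT _)) (hTJ (heT _)) (Ioo_subset_Icc_self (hc i))
  · simp [Finset.card_image_of_injective _ hmono.injective]
  · intro t ht
    obtain ⟨i, -, rfl⟩ := Finset.mem_image.1 ht
    exact hc0 i

/-- The mean value inequality for `derivWithin` on an order-connected subset of diameter `h`. -/
theorem abs_sub_le_of_abs_derivWithin_le {s J : Set ℝ} (hJs : J ⊆ s) (hJ : J.OrdConnected)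
    {h C : ℝ} (hC : 0 ≤ C) (hdiam : ∀ x ∈ J, ∀ y ∈ J, |x - y| ≤ h) {g : ℝ → ℝ}
    (hg : DifferentiableOn ℝ g s) (hb : ∀ x ∈ J, |derivWithin g s x| ≤ C)
    {x y : ℝ} (hx : x ∈ J) (hy : y ∈ J) : |g x - g y| ≤ C * h := by
  have := Convex.norm_image_sub_le_of_norm_hasDerivWithin_le
    (fun z hz => ((hg z (hJs hz)).hasDerivWithinAt.mono hJs)) hb hJ.convex hy hx
  exact this.trans (mul_le_mul_of_nonneg_left (hdiam x hx y hy) hC)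

/-- A `C^n` function with `n` zeros in a set of diameter `h` is of size `O(h ^ n)` on that set. -/
theorem abs_le_mul_pow_of_zeros {s J : Set ℝ} (hs : UniqueDiffOn ℝ s) (hJs : J ⊆ s)
    (hJ : J.OrdConnected) {h M : ℝ} (hh : 0 ≤ h) (hM : 0 ≤ M)
    (hdiam : ∀ x ∈ J, ∀ y ∈ J, |x - y| ≤ h) (n : ℕ) :
    ∀ (g : ℝ → ℝ) (T : Finset ℝ), ContDiffOn ℝ n g s →
      (∀ x ∈ s, |iteratedDerivWithin n g s x| ≤ M) → ↑T ⊆ J → T.card = n →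
      (∀ t ∈ T, g t = 0) → ∀ x ∈ J, |g x| ≤ M * h ^ n := by
  induction n with
  | zero =>
    intro g T _ hb _ _ _ x hx
    simpa using hb x (hJs hx)
  | succ n ih =>
    intro g T hg hb hTJ hT hz x hx
    obtain ⟨T', hT'J, hT', hz'⟩ :=
      exists_finset_zeros_derivWithin hJs hJ hg.continuousOn hTJ hT hz
    have hd : ∀ y ∈ J, |derivWithin g s y| ≤ M * h ^ n := by
      refine ih _ T' (hg.derivWithin hs (by norm_cast)) ?_ hT'J hT' hz'
      intro y hy
      rw [← iteratedDerivWithin_succ']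
      exact hb y hy
    obtain ⟨t, ht⟩ : T.Nonempty := Finset.card_pos.1 (by omega)
    have := abs_sub_le_of_abs_derivWithin_le hJs hJ (by positivity) hdiam
      (hg.differentiableOn (by simp)) hd hx (hTJ ht)
    rwa [hz t ht, sub_zero, mul_assoc, ← pow_succ] at this

/-- Points of `[1, N]` at distance at least `1` have `α`-th powers at distance at least
`-α * N ^ (α - 1)`, for negative `α`. -/
theorem neg_mul_rpow_le_rpow_sub_rpow {α a b N : ℝ} (hα : α < 0) (ha : 1 ≤ a) (hab : a + 1 ≤ b)
    (hbN : b ≤ N) : -α * N ^ (α - 1) ≤ a ^ α - b ^ α := by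
  have hlt : a < b := by linarith
  obtain ⟨c, hc, hceq⟩ := exists_hasDerivAt_eq_slope (fun x : ℝ => x ^ α)
    (fun x => α * x ^ (α - 1)) hlt
    (continuousOn_id.rpow_const fun x hx => Or.inl (by
      have := hx.1
      simp only [id]
      linarith))
    (fun x hx => Real.hasDerivAt_rpow_const (Or.inl (by have := hx.1; linarith)))
  have hc0 : 0 < c := by linarith [hc.1]
  have h1 : N ^ (α - 1) ≤ c ^ (α - 1) :=
    Real.rpow_le_rpow_of_nonpos hc0 (by linarith [hc.2]) (by linarith)
  have h2 : 0 ≤ c ^ (α - 1) := by positivity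
  have h3 : α * c ^ (α - 1) * (b - a) = b ^ α - a ^ α := by
    rw [hceq, div_mul_cancel₀ _ (by linarith)]
  have h4 : -α * N ^ (α - 1) ≤ -α * c ^ (α - 1) :=
    mul_le_mul_of_nonneg_left h1 (by linarith)
  have h5 : 0 ≤ -α * c ^ (α - 1) := mul_nonneg (by linarith) h2
  nlinarith [mul_nonneg h5 (by linarith : 0 ≤ b - a - 1)]

/-- for `α < 0` and an integer `d > 1 − α`, no C^d function
`f : [-1,1] → ℝ` has `Δ_α = {m^α : m ≥ 1}` contained in its set of critical
values. -/
theorem stmt_13 (α : ℝ) (hα : α < 0) (d : ℕ) (hd : (1 : ℝ) - α < d) :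
    ¬ ∃ f : ℝ → ℝ, ContDiffOn ℝ d f (Icc (-1 : ℝ) 1) ∧
      {x : ℝ | ∃ m : ℕ, 1 ≤ m ∧ x = (m : ℝ) ^ α} ⊆
        f '' {x ∈ Icc (-1 : ℝ) 1 | derivWithin f (Icc (-1 : ℝ) 1) x = 0} := by
  classical
  rintro ⟨f, hf, hsub⟩
  set s := Icc (-1 : ℝ) 1
  have hs : UniqueDiffOn ℝ s := uniqueDiffOn_Icc (by norm_num)
  have hd2 : 2 ≤ d := by
    have : (1 : ℝ) < d := by linarith
    exact_mod_cast this
  obtain ⟨n, rfl⟩ : ∃ n, d = n + 1 := ⟨d - 1, by omega⟩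
  obtain ⟨M, hMb⟩ := isCompact_Icc.exists_bound_of_continuousOn
    (hf.continuousOn_iteratedDerivWithin le_rfl hs)
  have hM : 0 ≤ M := (norm_nonneg _).trans (hMb 0 (by simp))
  have hx : ∀ m : ℕ, ∃ x, 1 ≤ m → x ∈ s ∧ derivWithin f s x = 0 ∧ f x = (m : ℝ) ^ α := by
    intro m
    by_cases hm : 1 ≤ m
    · obtain ⟨x, ⟨h1, h2⟩, h3⟩ := hsub ⟨m, hm, rfl⟩
      exact ⟨x, fun _ => ⟨h1, h2, h3⟩⟩
    · exact ⟨0, fun h => absurd h hm⟩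
  choose x hx using hx
  have hgap : ∀ N m m' : ℕ, 1 ≤ m → m < m' → m' ≤ N →
      -α * (N : ℝ) ^ (α - 1) ≤ f (x m) - f (x m') := by
    intro N m m' hm hmm hN
    rw [(hx m hm).2.2, (hx m' (by omega)).2.2]
    exact neg_mul_rpow_le_rpow_sub_rpow hα (by exact_mod_cast hm) (by exact_mod_cast hmm)
      (by exact_mod_cast hN)
  have hinj : ∀ m m' : ℕ, 1 ≤ m → m < m' → x m ≠ x m' := by
    intro m m' hm hmm heq
    have h1 := hgap m' m m' hm hmm le_rfl
    rw [heq, sub_self] at h1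
    have h2 : (0 : ℝ) < m' := by exact_mod_cast (by omega : 0 < m')
    have := mul_pos (neg_pos.2 hα) (Real.rpow_pos_of_pos h2 (α - 1))
    linarith
  have key : ∀ K : ℕ, 1 ≤ K →
      -α * (((K + 1) * (n + 1) : ℕ) : ℝ) ^ (α - 1) ≤ M * (2 / K : ℝ) ^ (n + 1) := by
    intro K hK
    have hK0 : (0 : ℝ) < K := by exact_mod_cast hK
    set N := (K + 1) * (n + 1)
    let cell : ℝ → ℕ := fun y => ⌊(y + 1) * K / 2⌋₊
    have hmaps : ∀ m ∈ Finset.Icc 1 N, cell (x m) ∈ Finset.range (K + 1) := by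
      intro m hm
      have h1 := (hx m (Finset.mem_Icc.1 hm).1).1.2
      rw [Finset.mem_range, Nat.lt_succ_iff]
      refine Nat.floor_le_of_le ?_
      nlinarith
    obtain ⟨k, -, hk⟩ := Finset.exists_le_card_fiber_of_mul_le_card_of_maps_to hmaps
      (n := n + 1) (by simp) (by simp [N])
    set J := {y ∈ s | cell y = k}
    have hJs : J ⊆ s := sep_subset _ _
    have hJ : J.OrdConnected := by
      refine ⟨fun a ha b hb y hy => ⟨⟨ha.1.1.trans hy.1, hy.2.trans hb.1.2⟩, ?_⟩⟩
      apply le_antisymm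
      · rw [← hb.2]
        exact Nat.floor_mono (by have := hy.2; gcongr)
      · rw [← ha.2]
        exact Nat.floor_mono (by have := hy.1; gcongr)
    have hJk : ∀ y ∈ J, (k : ℝ) ≤ (y + 1) * K / 2 ∧ (y + 1) * K / 2 < k + 1 := by
      intro y hy
      have h0 : 0 ≤ (y + 1) * K / 2 := by
        have := hy.1.1
        have : 0 ≤ y + 1 := by linarith
        positivity
      exact (Nat.floor_eq_iff h0).1 hy.2
    have hdiam : ∀ y ∈ J, ∀ z ∈ J, |y - z| ≤ 2 / K := by
      intro y hy z hz
      have h1 := hJk y hy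
      have h2 := hJk z hz
      rw [le_div_iff₀ hK0, ← abs_of_pos hK0, ← abs_mul, abs_le]
      constructor <;> linarith
    obtain ⟨S, hS, hScard⟩ := Finset.exists_subset_card_eq hk
    have hSmem : ∀ m ∈ S, 1 ≤ m ∧ m ≤ N ∧ x m ∈ J := by
      intro m hm
      obtain ⟨h1, h2⟩ := Finset.mem_filter.1 (hS hm)
      obtain ⟨h3, h4⟩ := Finset.mem_Icc.1 h1
      exact ⟨h3, h4, (hx m h3).1, h2⟩
    obtain ⟨a, ha, b, hb, hab⟩ := Finset.one_lt_card.1 (by omega : 1 < S.card)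
    wlog hlt : a < b generalizing a b
    · exact this b hb a ha hab.symm (by omega)
    have hderiv : ∀ y ∈ J, |derivWithin f s y| ≤ M * (2 / K : ℝ) ^ n := by
      refine abs_le_mul_pow_of_zeros hs hJs hJ (by positivity) hM hdiam n _ ((S.erase a).image x)
        (hf.derivWithin hs (by norm_cast)) ?_ ?_ ?_ ?_
      · intro y hy
        rw [← iteratedDerivWithin_succ']
        exact hMb y hy
      · intro y hy
        obtain ⟨m, hm, rfl⟩ := Finset.mem_image.1 (Finset.mem_coe.1 hy)
        exact (hSmem m (Finset.mem_of_mem_erase hm)).2.2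
      · rw [Finset.card_image_of_injOn, Finset.card_erase_of_mem ha, hScard]
        · rfl
        · intro m hm m' hm' heq
          have h1 := (hSmem m (Finset.mem_of_mem_erase hm)).1
          have h2 := (hSmem m' (Finset.mem_of_mem_erase hm')).1
          rcases lt_trichotomy m m' with h | h | h
          · exact absurd heq (hinj m m' h1 h)
          · exact h
          · exact absurd heq.symm (hinj m' m h2 h)
      · intro y hy
        obtain ⟨m, hm, rfl⟩ := Finset.mem_image.1 hy
        exact (hx m (hSmem m (Finset.mem_of_mem_erase hm)).1).2.1
    have hosc := abs_sub_le_of_abs_derivWithin_le hJs hJ (by positivity) hdiam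
      (hf.differentiableOn (by simp)) hderiv (hSmem a ha).2.2 (hSmem b hb).2.2
    rw [mul_assoc, ← pow_succ] at hosc
    exact (hgap N a b (hSmem a ha).1 hlt (hSmem b hb).2.1).trans ((le_abs_self _).trans hosc)
  set p : ℝ := (n + 1 : ℕ) + (α - 1) with hp
  have hp0 : 0 < p := by linarith
  set D : ℝ := 2 * (n + 1 : ℕ) with hD
  have hD0 : 0 < D := by positivity
  set c : ℝ := -α * D ^ (α - 1) with hc
  have hc0 : 0 < c := mul_pos (neg_pos.2 hα) (Real.rpow_pos_of_pos hD0 _)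
  have hbound : ∀ K : ℕ, 1 ≤ K → (K : ℝ) ^ p ≤ M * 2 ^ (n + 1) / c := by
    intro K hK
    have hK1 : (1 : ℝ) ≤ K := by exact_mod_cast hK
    have hK0 : (0 : ℝ) < K := by linarith
    have h1 : (D * K) ^ (α - 1) ≤ (((K + 1) * (n + 1) : ℕ) : ℝ) ^ (α - 1) := by
      refine Real.rpow_le_rpow_of_nonpos (by positivity) ?_ (by linarith)
      rw [hD]
      push_cast
      nlinarith [(n.cast_nonneg : (0 : ℝ) ≤ n)]
    have h2 : c * (K : ℝ) ^ (α - 1) ≤ M * (2 / K : ℝ) ^ (n + 1) := by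
      rw [hc, mul_assoc, ← Real.mul_rpow hD0.le hK0.le]
      exact (mul_le_mul_of_nonneg_left h1 (by linarith)).trans (key K hK)
    rw [div_pow, ← mul_div_assoc, le_div_iff₀ (by positivity)] at h2
    rw [le_div_iff₀ hc0, hp, Real.rpow_add hK0, Real.rpow_natCast]
    linarith
  obtain ⟨K, hK, hK1⟩ := ((((tendsto_rpow_atTop hp0).comp
    (tendsto_natCast_atTop_atTop (R := ℝ))).eventually_gt_atTop
      (M * 2 ^ (n + 1) / c)).and (Filter.eventually_ge_atTop 1)).exists
  exact absurd (hbound K hK1) (not_le.2 hK)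
end

section
/- Let n ≥ 1, d ≥ 1 be integers, r > 0, c > 0, λ ≥ 0, and let f : B^n_r → ℝ be a C^d function whose set of λ-near-critical values Δ(f,λ) = f({x ∈ B^n_r : ‖∇f(x)‖ ≤ λ}) satisfies: M(ε', Δ(f,λ)) ≤ c·(1 + λ·(r/ε')) for every ε' ≥ R_d(f), and M(ε', Δ(f,λ)) ≤ c·[(R_d(f)/ε')^{n/d} + λ·(r/ε')·(R_d(f)/ε')^{(n−1)/d}] for every 0 < ε' ≤ R_d(f). If ε > 0 is such that M(ε, Δ(f,λ)) > c·(1 + λ·(r/ε)), and η > 1 is the unique solution of M(ε, Δ(f,λ)) = c·[η^{n/d} + λ·(r/ε)·η^{(n−1)/d}], then R_d(f) ≥ η · ε. -/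
open Metric Set

/-- The Taylor constant `R_d(f) = (r^d/d!) · sup_{x ∈ B^n_r} ‖D^d f(x)‖`. -/
noncomputable def taylorConst (n d : ℕ) (r : ℝ) (f : EuclideanSpace ℝ (Fin n) → ℝ) : ℝ :=
  (r ^ d / d.factorial) *
    ⨆ x ∈ closedBall (0 : EuclideanSpace ℝ (Fin n)) r,
      ‖iteratedFDerivWithin ℝ d f (closedBall (0 : EuclideanSpace ℝ (Fin n)) r) x‖

/-- The set of λ-near-critical values of `f` on the ball of radius `r`:
`Δ(f,λ) = f({x ∈ B^n_r : ‖∇f(x)‖ ≤ λ})`. -/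
noncomputable def nearCritValues (n : ℕ) (r lam : ℝ) (f : EuclideanSpace ℝ (Fin n) → ℝ) :
    Set ℝ :=
  f '' {x ∈ closedBall (0 : EuclideanSpace ℝ (Fin n)) r |
    ‖fderivWithin ℝ f (closedBall (0 : EuclideanSpace ℝ (Fin n)) r) x‖ ≤ lam}

/-- Theorem 3.2, m = 1, near-critical parameter λ: if the
covering number at scale ε exceeds the polynomial bound, and `η > 1` solves
`M(ε, Δ(f,λ)) = c·(η^(n/d) + λ·(r/ε)·η^((n−1)/d))`, then `R_d(f) ≥ η·ε`. -/
theorem stmt_14 (n d : ℕ) (hn : 1 ≤ n) (hd : 1 ≤ d) (r c lam : ℝ)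
    (hr : 0 < r) (hc : 0 < c) (hlam : 0 ≤ lam)
    (f : EuclideanSpace ℝ (Fin n) → ℝ)
    (hf : ContDiffOn ℝ d f (closedBall (0 : EuclideanSpace ℝ (Fin n)) r))
    (hbig : ∀ ε' : ℝ, taylorConst n d r f ≤ ε' →
      (coveringNumber ε' (nearCritValues n r lam f) : ℝ) ≤ c * (1 + lam * (r / ε')))
    (hsmall : ∀ ε' : ℝ, 0 < ε' → ε' ≤ taylorConst n d r f →
      (coveringNumber ε' (nearCritValues n r lam f) : ℝ)
        ≤ c * ((taylorConst n d r f / ε') ^ ((n : ℝ) / d)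
            + lam * (r / ε') * (taylorConst n d r f / ε') ^ (((n : ℝ) - 1) / d)))
    (ε : ℝ) (hε : 0 < ε)
    (hM : c * (1 + lam * (r / ε)) < (coveringNumber ε (nearCritValues n r lam f) : ℝ))
    (η : ℝ) (hη : 1 < η)
    (hsol : (coveringNumber ε (nearCritValues n r lam f) : ℝ)
      = c * (η ^ ((n : ℝ) / d) + lam * (r / ε) * η ^ (((n : ℝ) - 1) / d))) :
    taylorConst n d r f ≥ η * ε := by
  set R := taylorConst n d r f
  have hεR : ε < R := by
    by_contra! h
    exact (hbig ε h).not_gt hM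
  by_contra! hlt
  have hd0 : (0 : ℝ) < d := by exact_mod_cast hd
  have hn1 : (1 : ℝ) ≤ n := by exact_mod_cast hn
  have hq0 : 0 ≤ R / ε := (div_pos (hε.trans hεR) hε).le
  have hqη : R / ε < η := (div_lt_iff₀ hε).mpr hlt
  have hlead : (R / ε) ^ ((n : ℝ) / d) < η ^ ((n : ℝ) / d) :=
    Real.rpow_lt_rpow hq0 hqη (by positivity)
  have hlower : (R / ε) ^ (((n : ℝ) - 1) / d) ≤ η ^ (((n : ℝ) - 1) / d) :=
    Real.rpow_le_rpow hq0 hqη.le (div_nonneg (sub_nonneg.mpr hn1) hd0.le)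
  have hcoef : 0 ≤ lam * (r / ε) := by positivity
  have hle := hsmall ε hε hεR.le
  rw [hsol] at hle
  exact hle.not_gt (mul_lt_mul_of_pos_left
    (add_lt_add_of_lt_of_le hlead (mul_le_mul_of_nonneg_left hlower hcoef)) hc)
end
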